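/- For every planar graph G and every ball hypergraph 𝓗 of G, τ(𝓗) ≤ 48e·ν(𝓗)·log(66e·ν(𝓗)), where e is the base of the natural logarithm and log is the natural logarithm. -/

import Mathlib

/-- The ball of radius `r` centered at `v` in the graph metric of `G`:
all vertices `u` with `d_G(v,u) ≤ r` (in particular, `u` must be reachable from `v`). -/
def SimpleGraph.gBall {V : Type*} (G : SimpleGraph V) (v : V) (r : ℕ) : Set V :=
  {u | G.Reachable v u ∧ G.dist v u ≤ r}

/-- A ball hypergraph of `G` is given by its edge set `E`: a collection of subsets of
`V(G)`, each of which is a ball of `G`. -/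
def IsBallHypergraph {V : Type*} (G : SimpleGraph V) (E : Set (Set V)) : Prop :=
  ∀ e ∈ E, ∃ v r, e = G.gBall v r

/-- `H` is a minor of `G`: there are pairwise disjoint connected nonempty branch sets
in `G`, one for each vertex of `H`, with an edge of `G` between the branch sets of any
two adjacent vertices of `H`. -/
def GraphMinor {W : Type*} {V : Type*} (H : SimpleGraph W) (G : SimpleGraph V) : Prop :=
  ∃ f : W → Set V,
    (∀ w, (G.induce (f w)).Connected) ∧
    (Pairwise fun w₁ w₂ => Disjoint (f w₁) (f w₂)) ∧
    (∀ w₁ w₂, H.Adj w₁ w₂ → ∃ u ∈ f w₁, ∃ v ∈ f w₂, G.Adj u v)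

/-- The matching number of the hypergraph with edge set `E`: the maximum number of
pairwise disjoint edges. -/
noncomputable def matchingNumber {V : Type*} [Fintype V] (E : Set (Set V)) : ℕ :=
  sSup {n | ∃ M : Finset (Set V), ↑M ⊆ E ∧ (M : Set (Set V)).Pairwise Disjoint ∧ M.card = n}

/-- The transversal number of the hypergraph with edge set `E`: the minimum size of a
set of vertices meeting every edge. -/
noncomputable def transversalNumber {V : Type*} [Fintype V] (E : Set (Set V)) : ℕ :=
  sInf {n | ∃ T : Finset V, (∀ e ∈ E, ∃ v ∈ T, v ∈ e) ∧ T.card = n}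


/-- A graph is planar iff it can be embedded in the plane without edge crossings;
by Wagner's theorem this holds if and only if it has neither a `K₅` minor nor a
`K₃,₃` minor, which we take as the (combinatorial) definition of planarity. -/
def IsPlanar {V : Type*} (G : SimpleGraph V) : Prop :=
  ¬ GraphMinor (⊤ : SimpleGraph (Fin 5)) G ∧
    ¬ GraphMinor (completeBipartiteGraph (Fin 3) (Fin 3)) G

/-- `G` has a `K₅` minor all of whose branch sets lie inside `S`. -/
def HasK5MinorIn {V : Type*} (G : SimpleGraph V) (S : Set V) : Prop :=
  ∃ f : Fin 5 → Set V,
    (∀ w, f w ⊆ S) ∧ (∀ w, (G.induce (f w)).Connected) ∧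
    (Pairwise fun w₁ w₂ => Disjoint (f w₁) (f w₂)) ∧
    (∀ w₁ w₂, w₁ ≠ w₂ → ∃ u ∈ f w₁, ∃ v ∈ f w₂, G.Adj u v)

theorem HasK5MinorIn.graphMinor {V : Type*} {G : SimpleGraph V} {S : Set V}
    (h : HasK5MinorIn G S) : GraphMinor (⊤ : SimpleGraph (Fin 5)) G := by
  obtain ⟨f, -, h1, h2, h3⟩ := h
  exact ⟨f, h1, h2, fun a b hab => h3 a b (by simpa using hab)⟩

theorem reachable_induce_mono {V : Type*} {G : SimpleGraph V} {s t : Set V} (hst : s ⊆ t)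
    {a b : V} (ha : a ∈ s) (hb : b ∈ s) (h : (G.induce s).Reachable ⟨a, ha⟩ ⟨b, hb⟩) :
    (G.induce t).Reachable ⟨a, hst ha⟩ ⟨b, hst hb⟩ :=
  h.map (SimpleGraph.induceHomOfLE G hst).toHom

/-- Blowing up a connected set of vertices of `K` into connected sets of `G` that realise the
adjacencies of `K` yields a connected set. -/
theorem connected_induce_biUnion {ι V : Type*} {K : SimpleGraph ι} {G : SimpleGraph V}
    {S : Set ι} {C : ι → Set V} (hS : (K.induce S).Connected)
    (hC : ∀ i ∈ S, (G.induce (C i)).Connected)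
    (hadj : ∀ i ∈ S, ∀ j ∈ S, K.Adj i j → ∃ a ∈ C i, ∃ b ∈ C j, G.Adj a b) :
    (G.induce (⋃ i ∈ S, C i)).Connected := by
  have hsub : ∀ i ∈ S, C i ⊆ ⋃ i ∈ S, C i := fun i hi => Set.subset_biUnion_of_mem hi
  have key : ∀ i j : S, (K.induce S).Reachable i j →
      ∀ a (ha : a ∈ C i) b (hb : b ∈ C j),
        (G.induce (⋃ i ∈ S, C i)).Reachable ⟨a, hsub i i.2 ha⟩ ⟨b, hsub j j.2 hb⟩ := by
    intro i j hij
    rw [SimpleGraph.reachable_iff_reflTransGen] at hij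
    induction hij with
    | refl =>
      intro a ha b hb
      exact reachable_induce_mono (hsub i i.2) ha hb ((hC i i.2).preconnected _ _)
    | @tail j k _ hjk ih =>
      intro a ha b hb
      obtain ⟨c, hc, d, hd, hcd⟩ := hadj j j.2 k k.2 hjk
      refine (ih a ha c hc).trans (SimpleGraph.Reachable.trans (v := ⟨d, hsub k k.2 hd⟩) ?_ ?_)
      · exact SimpleGraph.Adj.reachable hcd
      · exact reachable_induce_mono (hsub k k.2) hd hb ((hC k k.2).preconnected _ _)
  rw [SimpleGraph.connected_iff]
  constructor
  · rintro ⟨a, ha⟩ ⟨b, hb⟩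
    simp only [Set.mem_iUnion, exists_prop] at ha hb
    obtain ⟨i, hi, ha⟩ := ha
    obtain ⟨j, hj, hb⟩ := hb
    exact key ⟨i, hi⟩ ⟨j, hj⟩ (hS.preconnected _ _) a ha b hb
  · obtain ⟨i, hi⟩ := hS.nonempty
    obtain ⟨a, ha⟩ := (hC i hi).nonempty
    exact ⟨⟨a, hsub i hi ha⟩⟩

/-- A `K₅` minor of `K` can be transferred to `G` along a family of branch sets. -/
theorem HasK5MinorIn.transfer {ι V : Type*} {K : SimpleGraph ι} {G : SimpleGraph V}
    {S : Set ι} {T : Set V} {C : ι → Set V} (h : HasK5MinorIn K S)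
    (hT : ∀ i ∈ S, C i ⊆ T) (hC : ∀ i ∈ S, (G.induce (C i)).Connected)
    (hdisj : ∀ i ∈ S, ∀ j ∈ S, i ≠ j → Disjoint (C i) (C j))
    (hadj : ∀ i ∈ S, ∀ j ∈ S, K.Adj i j → ∃ a ∈ C i, ∃ b ∈ C j, G.Adj a b) :
    HasK5MinorIn G T := by
  obtain ⟨f, hfS, hconn, hd, ha⟩ := h
  refine ⟨fun w => ⋃ i ∈ f w, C i, fun w => ?_, fun w => ?_, fun w₁ w₂ hw => ?_,
    fun w₁ w₂ hw => ?_⟩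
  · exact Set.iUnion₂_subset fun i hi => hT i (hfS w hi)
  · exact connected_induce_biUnion (hconn w) (fun i hi => hC i (hfS w hi))
      fun i hi j hj => hadj i (hfS w hi) j (hfS w hj)
  · simp only [Set.disjoint_iUnion_left, Set.disjoint_iUnion_right]
    intro i hi j hj
    refine hdisj _ (hfS _ ‹_›) _ (hfS _ ‹_›) ?_
    rintro rfl
    exact Set.disjoint_left.1 (hd hw) ‹_› ‹_›
  · obtain ⟨i, hi, j, hj, hij⟩ := ha w₁ w₂ hw
    obtain ⟨a, hai, b, hbj, hab⟩ := hadj i (hfS _ hi) j (hfS _ hj) hij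
    exact ⟨a, Set.mem_biUnion hi hai, b, Set.mem_biUnion hj hbj, hab⟩

theorem connected_induce_singleton {V : Type*} (G : SimpleGraph V) (v : V) :
    (G.induce {v}).Connected := by
  rw [SimpleGraph.induce_singleton_eq_top]
  exact SimpleGraph.connected_top

theorem HasK5MinorIn.mono {V : Type*} {G H : SimpleGraph V} {S T : Set V}
    (h : HasK5MinorIn H S) (hHG : H ≤ G) (hST : S ⊆ T) : HasK5MinorIn G T :=
  h.transfer (C := fun i => {i}) (fun i hi => by simpa using hST hi)
    (fun i _ => connected_induce_singleton G i) (fun i _ j _ hij => by simpa using hij)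
    fun i _ j _ hij => ⟨i, rfl, j, rfl, hHG hij⟩

/-- Contraction of the edge `uv`: the vertex `u` is merged into `v`. -/
def contractEdge {V : Type*} (G : SimpleGraph V) (u v : V) : SimpleGraph V where
  Adj a b := a ≠ b ∧ a ≠ u ∧ b ≠ u ∧ (G.Adj a b ∨ (a = v ∧ G.Adj u b) ∨ (b = v ∧ G.Adj u a))
  symm := ⟨fun a b h => ⟨h.1.symm, h.2.2.1, h.2.1, by
    rcases h.2.2.2 with h | h | h
    · exact Or.inl h.symm
    · exact Or.inr (Or.inr h)
    · exact Or.inr (Or.inl h)⟩⟩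
  loopless := ⟨fun a h => h.1 rfl⟩

theorem HasK5MinorIn.of_contractEdge {V : Type*} {G : SimpleGraph V} {u v : V}
    {S : Set V} (huv : G.Adj u v) (hu : u ∈ S) (h : HasK5MinorIn (contractEdge G u v) (S \ {u})) :
    HasK5MinorIn G S := by
  classical
  refine h.transfer (C := fun i => if i = v then {u, v} else {i}) ?_ ?_ ?_ ?_
  · intro i hi
    split_ifs with h
    · subst h
      rintro x (rfl | rfl)
      exacts [hu, hi.1]
    · simpa using hi.1
  · intro i hi
    by_cases hiv : i = v
    · have hC : (if i = v then {u, v} else {i} : Set V) = {u, v} := if_pos hiv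
      rw [hC]
      exact SimpleGraph.induce_pair_connected_of_adj huv
    · have hC : (if i = v then {u, v} else {i} : Set V) = {i} := if_neg hiv
      rw [hC]
      exact connected_induce_singleton G i
  · rintro i ⟨-, hi⟩ j ⟨-, hj⟩ hij
    simp only [Set.mem_singleton_iff] at hi hj
    rw [Set.disjoint_left]
    intro x
    split_ifs <;> simp only [Set.mem_insert_iff, Set.mem_singleton_iff] <;> grind
  · rintro i - j - ⟨hne, hi, hj, e | ⟨rfl, e⟩ | ⟨rfl, e⟩⟩
    · refine ⟨i, ?_, j, ?_, e⟩ <;> split_ifs with h <;> simp [h]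
    · refine ⟨u, by simp, j, ?_, e⟩
      split_ifs with h <;> simp [h]
    · refine ⟨i, ?_, u, by simp, e.symm⟩
      split_ifs with h <;> simp [h]

/-- The finite set of neighbours of a vertex. -/
noncomputable def nbrs {V : Type*} [Fintype V] (G : SimpleGraph V) (v : V) : Finset V :=
  open Classical in Finset.univ.filter fun u => G.Adj v u

@[simp]
theorem mem_nbrs {V : Type*} [Fintype V] {G : SimpleGraph V} {u v : V} :
    u ∈ nbrs G v ↔ G.Adj v u := by
  simp [nbrs]

/-- The finite set of ordered pairs of adjacent vertices. -/
noncomputable def adjPairs {V : Type*} [Fintype V] (G : SimpleGraph V) : Finset (V × V) :=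
  open Classical in Finset.univ.filter fun p => G.Adj p.1 p.2

@[simp]
theorem mem_adjPairs {V : Type*} [Fintype V] {G : SimpleGraph V} {p : V × V} :
    p ∈ adjPairs G ↔ G.Adj p.1 p.2 := by
  simp [adjPairs]

theorem card_adjPairs {V : Type*} [Fintype V] (G : SimpleGraph V) :
    (adjPairs G).card = ∑ v, (nbrs G v).card := by
  classical
  rw [adjPairs, Finset.card_filter, Fintype.sum_prod_type]
  refine Finset.sum_congr rfl fun v _ => ?_
  rw [nbrs, Finset.card_filter]

theorem hasK5MinorIn_of_clique {V : Type*} {G : SimpleGraph V} {S : Set V} {Q : Finset V}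
    (hQ : Q.card = 5) (hQS : (Q : Set V) ⊆ S)
    (hadj : ∀ a ∈ Q, ∀ b ∈ Q, a ≠ b → G.Adj a b) : HasK5MinorIn G S := by
  let e := (Q.equivFinOfCardEq hQ).symm
  have hne : ∀ w₁ w₂, w₁ ≠ w₂ → (e w₁ : V) ≠ e w₂ := fun w₁ w₂ hw h =>
    hw (e.injective (Subtype.ext h))
  refine ⟨fun w => {(e w : V)}, fun w => ?_, fun w => connected_induce_singleton G _,
    fun w₁ w₂ hw => ?_, fun w₁ w₂ hw => ?_⟩
  · simpa using hQS (e w).2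
  · simpa using hne w₁ w₂ hw
  · exact ⟨_, rfl, _, rfl, hadj _ (e w₁).2 _ (e w₂).2 (hne w₁ w₂ hw)⟩

/-- A wheel with hub `v` over `K₅` minus two disjoint edges contains a `K₅` minor. -/
theorem hasK5MinorIn_of_six {V : Type*} {G : SimpleGraph V} {S : Set V} {v p q a b c : V}
    (hS : ({v, p, q, a, b, c} : Set V) ⊆ S)
    (hv : G.Adj v p ∧ G.Adj v q ∧ G.Adj v a ∧ G.Adj v b ∧ G.Adj v c)
    (hp : G.Adj p a ∧ G.Adj p b ∧ G.Adj p c) (hq : G.Adj q a ∧ G.Adj q b ∧ G.Adj q c)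
    (hab : G.Adj a b) (hpq : p ≠ q) (hac : a ≠ c) (hbc : b ≠ c) : HasK5MinorIn G S := by
  obtain ⟨hvp, hvq, hva, hvb, hvc⟩ := hv
  obtain ⟨hpa, hpb, hpc⟩ := hp
  obtain ⟨hqa, hqb, hqc⟩ := hq
  simp only [Set.insert_subset_iff, Set.singleton_subset_iff] at hS
  obtain ⟨h1, h2, h3, h4, h5, h6⟩ := hS
  refine ⟨![{v}, {p, c}, {q}, {a}, {b}], ?_, ?_, ?_, ?_⟩
  · simp [Fin.forall_fin_succ, Set.insert_subset_iff, *]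
  · simp only [Fin.forall_fin_succ]
    exact ⟨connected_induce_singleton G v, SimpleGraph.induce_pair_connected_of_adj hpc,
      connected_induce_singleton G q, connected_induce_singleton G a,
      connected_induce_singleton G b, fun i => i.elim0⟩
  · have := hvp.ne; have := hvq.ne; have := hva.ne; have := hvb.ne; have := hvc.ne
    have := hpa.ne; have := hpb.ne; have := hpc.ne
    have := hqa.ne; have := hqb.ne; have := hqc.ne; have := hab.ne
    intro i j hij
    fin_cases i <;> fin_cases j <;>
      first
      | exact absurd rfl hij
      | simp [Set.disjoint_left]; grind
  · intro i j hij
    fin_cases i <;> fin_cases j <;>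
      first
      | exact absurd rfl hij
      | simp [hvp, hvq, hva, hvb, hvc, hpa, hpb, hqa, hqb, hqc, hab, hvp.symm, hvq.symm, hva.symm,
          hvb.symm, hpa.symm, hpb.symm, hqa.symm, hqb.symm, hqc.symm, hab.symm]

/-- If `v` has degree four or five and each edge at `v` lies in at least three triangles, then
the closed neighbourhood of `v` contains a `K₅` minor. -/
theorem hasK5MinorIn_of_nbrs {V : Type*} [Fintype V] [DecidableEq V] {G : SimpleGraph V}
    {S : Set V} {v : V} (hv : v ∈ S) (hS : ∀ u, G.Adj v u → u ∈ S) (h4 : 4 ≤ (nbrs G v).card)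
    (h5 : (nbrs G v).card ≤ 5) (htri : ∀ u, G.Adj v u → 3 ≤ (nbrs G u ∩ nbrs G v).card) :
    HasK5MinorIn G S := by
  by_cases hcl : ∀ a ∈ nbrs G v, ∀ b ∈ nbrs G v, a ≠ b → G.Adj a b
  · obtain ⟨A, hA, hA4⟩ := Finset.exists_subset_card_eq h4
    have hvA : v ∉ A := fun h => by simpa using hA h
    refine hasK5MinorIn_of_clique (Q := insert v A) (by simp [hvA, hA4]) ?_ ?_
    · intro x hx
      rcases Finset.mem_insert.1 (Finset.mem_coe.1 hx) with rfl | hx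
      exacts [hv, hS x (by simpa using hA hx)]
    · intro a ha b hb hab
      rcases Finset.mem_insert.1 ha with ha' | ha' <;>
        rcases Finset.mem_insert.1 hb with hb' | hb'
      · exact absurd (ha'.trans hb'.symm) hab
      · exact ha' ▸ mem_nbrs.1 (hA hb')
      · exact hb' ▸ (mem_nbrs.1 (hA ha')).symm
      · exact hcl a (hA ha') b (hA hb') hab
  · push Not at hcl
    obtain ⟨p, hp, q, hq, hpq, hnadj⟩ := hcl
    have hcard : (((nbrs G v).erase p).erase q).card + 2 = (nbrs G v).card := by
      rw [Finset.card_erase_of_mem (Finset.mem_erase.2 ⟨hpq.symm, hq⟩),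
        Finset.card_erase_of_mem hp]
      omega
    have hsub : ∀ x y, (x = p ∧ y = q ∨ x = q ∧ y = p) →
        nbrs G x ∩ nbrs G v = ((nbrs G v).erase p).erase q := by
      intro x y hxy
      apply Finset.eq_of_subset_of_card_le
      · intro z hz
        simp only [Finset.mem_inter, mem_nbrs, Finset.mem_erase] at hz ⊢
        refine ⟨?_, ?_, hz.2⟩
        · rintro rfl
          rcases hxy with ⟨rfl, rfl⟩ | ⟨rfl, rfl⟩
          exacts [hnadj hz.1, G.loopless.irrefl _ hz.1]
        · rintro rfl
          rcases hxy with ⟨rfl, rfl⟩ | ⟨rfl, rfl⟩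
          exacts [G.loopless.irrefl _ hz.1, hnadj hz.1.symm]
      · have := htri x (by
          rcases hxy with ⟨rfl, rfl⟩ | ⟨rfl, rfl⟩
          exacts [mem_nbrs.1 hp, mem_nbrs.1 hq])
        omega
    have hp' := hsub p q (Or.inl ⟨rfl, rfl⟩)
    have hq' := hsub q p (Or.inr ⟨rfl, rfl⟩)
    have h3 : (((nbrs G v).erase p).erase q).card = 3 := by
      have := htri p (by simpa using hp)
      rw [hp'] at this
      omega
    obtain ⟨a, b, c, hab, hac, hbc, habc⟩ := Finset.card_eq_three.1 h3
    have hN : ∀ x, G.Adj v x ↔ x = p ∨ x = q ∨ x = a ∨ x = b ∨ x = c := by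
      intro x
      have hx := congrArg (fun T => x ∈ T) habc
      simp only [Finset.mem_erase, mem_nbrs, Finset.mem_insert, Finset.mem_singleton,
        eq_iff_iff] at hx
      simp only [mem_nbrs] at hp hq
      by_cases h1 : x = p
      · simp [h1, hp]
      by_cases h2 : x = q
      · simp [h2, hq]
      simpa [h1, h2] using hx
    have hpx : ∀ x, x = a ∨ x = b ∨ x = c → G.Adj p x ∧ G.Adj q x := by
      intro x hx
      have hx1 : x ∈ ((nbrs G v).erase p).erase q := by rw [habc]; simpa using hx
      exact ⟨mem_nbrs.1 (Finset.mem_inter.1 (hp' ▸ hx1)).1,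
        mem_nbrs.1 (Finset.mem_inter.1 (hq' ▸ hx1)).1⟩
    have hva := (hN a).2 (by simp)
    have hvb := (hN b).2 (by simp)
    have hvc := (hN c).2 (by simp)
    have hvp := (hN p).2 (by simp)
    have hvq := (hN q).2 (by simp)
    have ha := hpx a (by simp)
    have hb := hpx b (by simp)
    have hc := hpx c (by simp)
    have habc' : G.Adj a b ∨ G.Adj a c := by
      by_contra! hcon
      have h2 : nbrs G a ∩ nbrs G v ⊆ {p, q} := by
        intro z hz
        simp only [Finset.mem_inter, mem_nbrs, hN] at hz
        simp only [Finset.mem_insert, Finset.mem_singleton]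
        rcases hz with ⟨hz, rfl | rfl | rfl | rfl | rfl⟩
        · simp
        · simp
        · exact absurd hz (G.loopless.irrefl _)
        · exact absurd hz hcon.1
        · exact absurd hz hcon.2
      have := (htri a hva).trans ((Finset.card_le_card h2).trans Finset.card_le_two)
      omega
    rcases habc' with h | h
    · refine hasK5MinorIn_of_six (v := v) (p := p) (q := q) (a := a) (b := b) (c := c) ?_
        ⟨hvp, hvq, hva, hvb, hvc⟩ ⟨ha.1, hb.1, hc.1⟩ ⟨ha.2, hb.2, hc.2⟩ h hpq hac hbc
      simp [Set.insert_subset_iff, *]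
    · refine hasK5MinorIn_of_six (v := v) (p := p) (q := q) (a := a) (b := c) (c := b) ?_
        ⟨hvp, hvq, hva, hvc, hvb⟩ ⟨ha.1, hc.1, hb.1⟩ ⟨ha.2, hc.2, hb.2⟩ h hpq hab hbc.symm
      simp [Set.insert_subset_iff, *]

theorem card_adjPairs_le_contractEdge {V : Type*} [Fintype V] [DecidableEq V]
    {G : SimpleGraph V} {u v : V} (huv : G.Adj u v) :
    (adjPairs G).card ≤
      (adjPairs (contractEdge G u v)).card + 2 + 2 * (nbrs G u ∩ nbrs G v).card := by
  set P := (adjPairs G).filter fun p => p.1 ≠ u ∧ p.2 ≠ u with hP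
  set R := (nbrs G u \ nbrs G v).erase v with hR
  have h1 : (adjPairs G).card ≤ P.card + (nbrs G u).card + (nbrs G u).card := by
    have hsub : adjPairs G ⊆ (P ∪ {u} ×ˢ nbrs G u) ∪ nbrs G u ×ˢ {u} := by
      rintro ⟨a, b⟩ hab
      simp only [mem_adjPairs] at hab
      by_cases ha : a = u
      · subst ha
        simp [hab]
      by_cases hb : b = u
      · subst hb
        simp [hab.symm]
      simp [hP, hab, ha, hb]
    refine (Finset.card_le_card hsub).trans ((Finset.card_union_le _ _).trans ?_)
    refine Nat.add_le_add ((Finset.card_union_le _ _).trans ?_) ?_ <;> simp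
  have h2 : (nbrs G u).card ≤ R.card + 1 + (nbrs G u ∩ nbrs G v).card := by
    have h3 := Finset.card_sdiff_add_card_inter (nbrs G u) (nbrs G v)
    have h4 : (nbrs G u \ nbrs G v).card ≤ R.card + 1 := by
      rw [hR]
      have := Finset.pred_card_le_card_erase (s := nbrs G u \ nbrs G v) (a := v)
      omega
    omega
  have h5 : P.card + R.card + R.card ≤ (adjPairs (contractEdge G u v)).card := by
    have hd1 : Disjoint P ({v} ×ˢ R) := by
      rw [Finset.disjoint_left]
      rintro ⟨a, b⟩ hab hab'
      simp only [hP, hR, Finset.mem_filter, mem_adjPairs, Finset.mem_product,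
        Finset.mem_singleton, Finset.mem_erase, Finset.mem_sdiff, mem_nbrs] at hab hab'
      exact hab'.2.2.2 (hab'.1 ▸ hab.1)
    have hd2 : Disjoint (P ∪ {v} ×ˢ R) (R ×ˢ {v}) := by
      rw [Finset.disjoint_left]
      rintro ⟨a, b⟩ hab hab'
      simp only [hP, hR, Finset.mem_union, Finset.mem_filter, mem_adjPairs, Finset.mem_product,
        Finset.mem_singleton, Finset.mem_erase, Finset.mem_sdiff, mem_nbrs] at hab hab'
      rcases hab with hab | hab
      · exact hab'.1.2.2 (hab'.2 ▸ hab.1.symm)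
      · exact hab'.1.1 hab.1
    have hcard : P.card + R.card + R.card = ((P ∪ {v} ×ˢ R) ∪ R ×ˢ {v}).card := by
      rw [Finset.card_union_of_disjoint hd2, Finset.card_union_of_disjoint hd1]
      simp
    rw [hcard]
    apply Finset.card_le_card
    rintro ⟨a, b⟩ hab
    have hne := huv.ne
    simp only [hP, hR, Finset.mem_union, Finset.mem_filter, mem_adjPairs, Finset.mem_product,
      Finset.mem_singleton, Finset.mem_erase, Finset.mem_sdiff, mem_nbrs] at hab
    rw [mem_adjPairs]
    rcases hab with (⟨hab, ha, hb⟩ | ⟨rfl, hb, hub, -⟩) | ⟨⟨ha, hua, -⟩, rfl⟩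
    · exact ⟨hab.ne, ha, hb, Or.inl hab⟩
    · exact ⟨Ne.symm hb, hne.symm, hub.ne.symm, Or.inr (Or.inl ⟨rfl, hub⟩)⟩
    · exact ⟨ha, hua.ne.symm, hne.symm, Or.inr (Or.inr ⟨rfl, hua⟩)⟩
  omega

/-- The graph obtained from `G` by deleting all edges at `v`. -/
def isolate {V : Type*} (G : SimpleGraph V) (v : V) : SimpleGraph V where
  Adj a b := G.Adj a b ∧ a ≠ v ∧ b ≠ v
  symm := ⟨fun _ _ h => ⟨h.1.symm, h.2.2, h.2.1⟩⟩
  loopless := ⟨fun a h => G.loopless.irrefl a h.1⟩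

theorem card_adjPairs_le_isolate {V : Type*} [Fintype V] (G : SimpleGraph V) (v : V) :
    (adjPairs G).card ≤ (adjPairs (isolate G v)).card + 2 * (nbrs G v).card := by
  classical
  have hsub : adjPairs G ⊆ (adjPairs (isolate G v) ∪ {v} ×ˢ nbrs G v) ∪ nbrs G v ×ˢ {v} := by
    rintro ⟨a, b⟩ hab
    simp only [mem_adjPairs] at hab
    by_cases ha : a = v
    · subst ha
      simp [hab]
    by_cases hb : b = v
    · subst hb
      simp [hab.symm]
    simp [isolate, hab, ha, hb]
  refine (Finset.card_le_card hsub).trans ((Finset.card_union_le _ _).trans ?_)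
  have := Finset.card_union_le (adjPairs (isolate G v)) ({v} ×ˢ nbrs G v)
  simp only [Finset.card_product, Finset.card_singleton] at this ⊢
  omega

theorem card_adjPairs_deleteEdge {V : Type*} [Fintype V] {G : SimpleGraph V} {u v : V}
    (huv : G.Adj u v) :
    (adjPairs G).card ≤ (adjPairs (G.deleteEdges {s(u, v)})).card + 2 ∧
      (adjPairs (G.deleteEdges {s(u, v)})).card < (adjPairs G).card := by
  classical
  constructor
  · have hsub : adjPairs G ⊆ adjPairs (G.deleteEdges {s(u, v)}) ∪ {(u, v), (v, u)} := by
      rintro ⟨a, b⟩ hab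
      simp only [mem_adjPairs] at hab
      simp only [Finset.mem_union, mem_adjPairs, SimpleGraph.deleteEdges_adj, hab,
        Finset.mem_insert, Finset.mem_singleton, Set.mem_singleton_iff, Sym2.eq_iff, Prod.mk.injEq]
      tauto
    exact (Finset.card_le_card hsub).trans ((Finset.card_union_le _ _).trans
      (Nat.add_le_add_left Finset.card_le_two _))
  · apply Finset.card_lt_card
    rw [Finset.ssubset_iff_of_subset]
    · exact ⟨(u, v), by simpa using huv, by simp⟩
    · intro p
      simp only [mem_adjPairs]
      exact fun h => SimpleGraph.deleteEdges_le _ h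

/-- **Mader's theorem** for `K₅`: a graph on `n ≥ 1` vertices with at least `3 * n - 2` edges has
a `K₅` minor. -/
theorem hasK5MinorIn_of_card_le {V : Type*} [Fintype V] (G : SimpleGraph V) (S : Finset V)
    (hGS : ∀ a b, G.Adj a b → a ∈ S) (hS : 1 ≤ S.card)
    (hcard : 6 * S.card ≤ (adjPairs G).card + 4) : HasK5MinorIn G (S : Set V) := by
  classical
  obtain ⟨n, hn⟩ : ∃ n, S.card = n := ⟨_, rfl⟩
  induction n using Nat.strong_induction_on generalizing G S with
  | _ n ih =>
  obtain ⟨m, hm⟩ : ∃ m, (adjPairs G).card = m := ⟨_, rfl⟩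
  induction m using Nat.strong_induction_on generalizing G with
  | _ m ih' =>
  have hpos : 0 < (adjPairs G).card := by omega
  obtain ⟨⟨a₀, b₀⟩, h₀⟩ := Finset.card_pos.1 hpos
  simp only [mem_adjPairs] at h₀
  have hS2 : 2 ≤ S.card := by
    have hsub : ({a₀, b₀} : Finset V) ⊆ S := by
      intro x hx
      simp only [Finset.mem_insert, Finset.mem_singleton] at hx
      rcases hx with rfl | rfl
      exacts [hGS _ _ h₀, hGS _ _ h₀.symm]
    rw [← Finset.card_pair h₀.ne]
    exact Finset.card_le_card hsub
  by_cases hdeg : ∀ v ∈ S, 6 ≤ (nbrs G v).card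
  · have hsum : 6 * S.card ≤ (adjPairs G).card := by
      rw [card_adjPairs, mul_comm]
      calc S.card * 6 = ∑ v ∈ S, 6 := by simp
        _ ≤ ∑ v ∈ S, (nbrs G v).card := Finset.sum_le_sum hdeg
        _ ≤ ∑ v, (nbrs G v).card :=
          Finset.sum_le_sum_of_subset (Finset.subset_univ S)
    have hdel := card_adjPairs_deleteEdge h₀
    have hle : G.deleteEdges {s(a₀, b₀)} ≤ G := SimpleGraph.deleteEdges_le _
    exact (ih' _ (by omega) (G.deleteEdges {s(a₀, b₀)}) (fun a b hab => hGS a b (hle hab))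
      (by omega) rfl).mono hle subset_rfl
  push Not at hdeg
  obtain ⟨v, hvS, hv⟩ := hdeg
  have herase := Finset.card_erase_of_mem hvS
  by_cases h3 : (nbrs G v).card ≤ 3
  · have hiso := card_adjPairs_le_isolate G v
    have hle : isolate G v ≤ G := fun a b h => h.1
    refine (ih _ ?_ (isolate G v) (S.erase v) (fun a b hab => ?_) ?_ ?_ rfl).mono hle ?_
    · omega
    · exact Finset.mem_erase.2 ⟨hab.2.1, hGS a b hab.1⟩
    · omega
    · omega
    · exact Finset.coe_subset.2 (Finset.erase_subset _ _)
  by_cases htri : ∀ u, G.Adj v u → 3 ≤ (nbrs G u ∩ nbrs G v).card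
  · exact hasK5MinorIn_of_nbrs hvS (fun u hu => hGS u v hu.symm) (by omega) (by omega) htri
  push Not at htri
  obtain ⟨u, hvu, hcommon⟩ := htri
  have huS : u ∈ S := hGS u v hvu.symm
  have herase' := Finset.card_erase_of_mem huS
  have hcontract := card_adjPairs_le_contractEdge hvu.symm
  refine HasK5MinorIn.of_contractEdge hvu.symm huS ?_
  have := ih _ (by omega) (contractEdge G u v) (S.erase u) (fun a b hab => ?_) (by omega)
    (by omega) rfl
  · rwa [Finset.coe_erase] at this
  · refine Finset.mem_erase.2 ⟨hab.2.1, ?_⟩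
    rcases hab.2.2.2 with h | ⟨rfl, -⟩ | ⟨-, h⟩
    exacts [hGS _ _ h, hvS, hGS _ _ h.symm]

/-- A family of height functions on the vertices of `G`: each `g i` changes by at most one along
an edge, and from every vertex of positive height other than the peak `x i` one can climb. -/
structure IsPeakFamily {ι V : Type*} (G : SimpleGraph V) (x : ι → V) (g : ι → V → ℕ) : Prop where
  lipschitz : ∀ i a b, G.Adj a b → g i a ≤ g i b + 1
  climb : ∀ i a, 0 < g i a → a ≠ x i → ∃ b, G.Adj a b ∧ g i b = g i a + 1
  le_peak : ∀ i a, g i a ≤ g i (x i)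
  peak_pos : ∀ i, 0 < g i (x i)
  dominant : ∀ i j, i ≠ j → g j (x i) < g i (x i)

/-- At `a`, the height function of `i` wins against that of `j`, ties being broken by `rk`. -/
def Beats {ι V : Type*} (rk : ι → ℕ) (g : ι → V → ℕ) (i j : ι) (a : V) : Prop :=
  g j a < g i a ∨ (g j a = g i a ∧ rk i ≤ rk j)

/-- The Voronoi cell of `i` with respect to the family `S`. -/
def voronoiCell {ι V : Type*} (rk : ι → ℕ) (g : ι → V → ℕ) (S : Set ι) (i : ι) : Set V :=
  {a | 0 < g i a ∧ ∀ j ∈ S, Beats rk g i j a}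

/-- The contact graph of the Voronoi cells of `S`. -/
def contactGraph {ι V : Type*} (G : SimpleGraph V) (rk : ι → ℕ) (g : ι → V → ℕ) (S : Set ι) :
    SimpleGraph ι where
  Adj i j := i ≠ j ∧ i ∈ S ∧ j ∈ S ∧
    ∃ a ∈ voronoiCell rk g S i, ∃ b ∈ voronoiCell rk g S j, G.Adj a b
  symm := ⟨fun _ _ ⟨h, hi, hj, a, ha, b, hb, hab⟩ => ⟨h.symm, hj, hi, b, hb, a, ha, hab.symm⟩⟩
  loopless := ⟨fun _ h => h.1 rfl⟩

section Voronoi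

variable {ι V : Type*} {G : SimpleGraph V} {x : ι → V} {g : ι → V → ℕ} {rk : ι → ℕ}

theorem beats_self (i : ι) (a : V) : Beats rk g i i a := Or.inr ⟨rfl, le_rfl⟩

theorem beats_of_not_beats {i j : ι} {a : V} (h : ¬ Beats rk g i j a) : Beats rk g j i a := by
  unfold Beats at *
  omega

theorem IsPeakFamily.peak_mem_voronoiCell (hg : IsPeakFamily G x g) (S : Set ι) (i : ι) :
    x i ∈ voronoiCell rk g S i := by
  refine ⟨hg.peak_pos i, fun j _ => ?_⟩
  by_cases h : i = j
  · subst h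
    exact beats_self _ _
  · exact Or.inl (hg.dominant i j h)

theorem IsPeakFamily.voronoiCell_connected (hg : IsPeakFamily G x g) (S : Set ι) (i : ι) :
    (G.induce (voronoiCell rk g S i)).Connected := by
  have hx := hg.peak_mem_voronoiCell (rk := rk) S i
  have key : ∀ n a (ha : a ∈ voronoiCell rk g S i), g i (x i) - g i a = n →
      (G.induce (voronoiCell rk g S i)).Reachable ⟨a, ha⟩ ⟨x i, hx⟩ := by
    intro n
    induction n with
    | zero =>
      intro a ha h0
      by_cases hax : a = x i
      · subst hax
        exact SimpleGraph.Reachable.refl _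
      · obtain ⟨b, -, hb⟩ := hg.climb i a ha.1 hax
        have := hg.le_peak i b
        omega
    | succ n ih =>
      intro a ha hn
      have hax : a ≠ x i := by
        rintro rfl
        omega
      obtain ⟨b, hab, hb⟩ := hg.climb i a ha.1 hax
      have hbc : b ∈ voronoiCell rk g S i := by
        refine ⟨by omega, fun j hj => ?_⟩
        have h1 := ha.2 j hj
        have h2 := hg.lipschitz j b a hab.symm
        unfold Beats at *
        omega
      refine SimpleGraph.Reachable.trans (v := ⟨b, hbc⟩) ?_ (ih b hbc (by omega))
      exact SimpleGraph.Adj.reachable hab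
  rw [SimpleGraph.connected_iff]
  exact ⟨fun a b => (key _ a a.2 rfl).trans (key _ b b.2 rfl).symm, ⟨⟨x i, hx⟩⟩⟩

/-- Two distinct Voronoi cells are disjoint. -/
theorem voronoiCell_disjoint (hrk : Function.Injective rk) {S : Set ι} {i j : ι} (hi : i ∈ S)
    (hj : j ∈ S) (hij : i ≠ j) : Disjoint (voronoiCell rk g S i) (voronoiCell rk g S j) := by
  rw [Set.disjoint_left]
  intro a ha hb
  have h1 := ha.2 j hj
  have h2 := hb.2 i hi
  have h3 := hrk.ne hij
  unfold Beats at *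
  omega

/-- A `K₅` minor of the contact graph of Voronoi cells gives a `K₅` minor of the graph. -/
theorem IsPeakFamily.hasK5MinorIn_of_contactGraph (hg : IsPeakFamily G x g)
    (hrk : Function.Injective rk) {S : Set ι} (h : HasK5MinorIn (contactGraph G rk g S) S) :
    HasK5MinorIn G Set.univ :=
  h.transfer (fun _ _ => Set.subset_univ _) (fun i _ => hg.voronoiCell_connected S i)
    (fun _ hi _ hj hij => voronoiCell_disjoint hrk hi hj hij) fun _ _ _ _ hij => hij.2.2.2

/-- Climbing from a vertex where `i` beats `j` to the peak of `j`, one crosses an edge at which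
`j` takes over. A property stable under climbing steps is preserved until the crossing. -/
theorem IsPeakFamily.exists_crossing (hg : IsPeakFamily G x g) {i j : ι} (hij : i ≠ j)
    (P : V → Prop) (hP : ∀ a b, G.Adj a b → g j b = g j a + 1 → P a → P b) {z : V}
    (hz : 0 < g j z) (hzb : Beats rk g i j z) (hPz : P z) :
    ∃ a b, G.Adj a b ∧ 0 < g j a ∧ g j b = g j a + 1 ∧ Beats rk g i j a ∧ Beats rk g j i b ∧
      P a ∧ P b := by
  obtain ⟨n, hn⟩ : ∃ n, g j (x j) - g j z = n := ⟨_, rfl⟩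
  induction n using Nat.strong_induction_on generalizing z with
  | _ n ih =>
  have hzx : z ≠ x j := by
    rintro rfl
    have := hg.dominant j i hij.symm
    unfold Beats at hzb
    omega
  obtain ⟨b, hzb', hb⟩ := hg.climb j z hz hzx
  have hPb := hP z b hzb' hb hPz
  have hle := hg.le_peak j b
  by_cases h : Beats rk g i j b
  · exact ih _ (by omega) (by omega) h hPb rfl
  · exact ⟨z, b, hzb', hz, hb, hzb, beats_of_not_beats h, hPz, hPb⟩

/-- Two height functions with a common positive vertex have a contact vertex: whenever no other
member of `S` is positive there, the two Voronoi cells touch. -/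
theorem IsPeakFamily.exists_contact (hg : IsPeakFamily G x g) {i j : ι} (hij : i ≠ j)
    (hz : ∃ z, 0 < g i z ∧ 0 < g j z) :
    ∃ v, 0 < g i v ∧ 0 < g j v ∧ ∀ S : Set ι, i ∈ S → j ∈ S →
      (∀ l ∈ S, 0 < g l v → l = i ∨ l = j) → (contactGraph G rk g S).Adj i j := by
  suffices H : ∀ i j : ι, i ≠ j → (∃ z, 0 < g j z ∧ Beats rk g i j z) →
      ∃ v, 0 < g i v ∧ 0 < g j v ∧ ∀ S : Set ι, i ∈ S → j ∈ S →
        (∀ l ∈ S, 0 < g l v → l = i ∨ l = j) → (contactGraph G rk g S).Adj i j by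
    obtain ⟨z, hzi, hzj⟩ := hz
    by_cases hb : Beats rk g i j z
    · exact H i j hij ⟨z, hzj, hb⟩
    · obtain ⟨v, h1, h2, h3⟩ := H j i hij.symm ⟨z, hzi, beats_of_not_beats hb⟩
      exact ⟨v, h2, h1, fun S hi hj hS => (h3 S hj hi fun l hl hlv => (hS l hl hlv).symm).symm⟩
  rintro i j hij ⟨z, hz, hzb⟩
  obtain ⟨a, b, hab, ha, hb, hba, hbb, -, -⟩ :=
    hg.exists_crossing hij (fun _ => True) (fun _ _ _ _ _ => trivial) hz hzb trivial
  have hai : 0 < g i a := by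
    unfold Beats at hba
    omega
  refine ⟨a, hai, ha, fun S hi hj hS => ⟨hij, hi, hj, a, ⟨hai, fun l hl => ?_⟩, b,
    ⟨by omega, fun l hl => ?_⟩, hab⟩⟩
  · by_cases hla : 0 < g l a
    · rcases hS l hl hla with rfl | rfl
      exacts [beats_self _ _, hba]
    · exact Or.inl (by omega)
  · by_cases hla : 0 < g l a
    · rcases hS l hl hla with rfl | rfl
      exacts [hbb, beats_self _ _]
    · have := hg.lipschitz l b a hab.symm
      exact Or.inl (by omega)

/-- If at `z` the heights of `i` and `j` exceed all others, then the Voronoi cells of `i` and `j`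
touch. -/
theorem IsPeakFamily.contactGraph_adj_of_top_two (hg : IsPeakFamily G x g) {i j : ι} (hij : i ≠ j)
    {S : Set ι} (hi : i ∈ S) (hj : j ∈ S) {z : V}
    (hz : ∀ l, l ≠ i → l ≠ j → g l z < g i z ∧ g l z < g j z) (hzi : 0 < g i z)
    (hzj : 0 < g j z) : (contactGraph G rk g S).Adj i j := by
  suffices H : ∀ i j : ι, i ≠ j → i ∈ S → j ∈ S → (∀ l, l ≠ i → l ≠ j → g l z < g j z) →
      0 < g j z → Beats rk g i j z → (contactGraph G rk g S).Adj i j by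
    by_cases hb : Beats rk g i j z
    · exact H i j hij hi hj (fun l h1 h2 => (hz l h1 h2).2) hzj hb
    · exact (H j i hij.symm hj hi (fun l h1 h2 => (hz l h2 h1).1) hzi
        (beats_of_not_beats hb)).symm
  intro i j hij hi hj hz hzj hzb
  obtain ⟨a, b, hab, ha, hb, hba, hbb, hPa, hPb⟩ :=
    hg.exists_crossing hij (fun a => ∀ l, l ≠ i → l ≠ j → g l a < g j a)
      (fun a b hab hb h l h1 h2 => by
        have := hg.lipschitz l b a hab.symm
        have := h l h1 h2
        omega) hzj hzb hz
  have hle : g j a ≤ g i a := by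
    unfold Beats at hba
    omega
  refine ⟨hij, hi, hj, a, ⟨by omega, fun l _ => ?_⟩, b, ⟨by omega, fun l _ => ?_⟩, hab⟩
  · by_cases h1 : l = i
    · subst h1
      exact beats_self _ _
    by_cases h2 : l = j
    · subst h2
      exact hba
    exact Or.inl ((hPa l h1 h2).trans_le hle)
  · by_cases h1 : l = j
    · subst h1
      exact beats_self _ _
    by_cases h2 : l = i
    · subst h2
      exact hbb
    exact Or.inl (hPb l h2 h1)

end Voronoi

/-- The height of `u` in the ball of radius `r` around `c`: it is `r + 1` at the center, decreases
with the distance and vanishes exactly outside of the ball. -/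
noncomputable def height {V : Type*} (G : SimpleGraph V) (c : V) (r : ℕ) (u : V) : ℕ :=
  open Classical in if G.Reachable c u then r + 1 - G.dist c u else 0

section Height

variable {V : Type*} {G : SimpleGraph V} {c u v : V} {r : ℕ}

theorem height_of_reachable (h : G.Reachable c u) : height G c r u = r + 1 - G.dist c u :=
  if_pos h

theorem height_of_not_reachable (h : ¬ G.Reachable c u) : height G c r u = 0 :=
  if_neg h

theorem reachable_of_height_pos (h : 0 < height G c r u) : G.Reachable c u := by
  by_contra hc
  rw [height_of_not_reachable hc] at h
  omega

theorem height_pos_iff : 0 < height G c r u ↔ u ∈ G.gBall c r := by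
  by_cases h : G.Reachable c u
  · rw [height_of_reachable h, SimpleGraph.gBall, Set.mem_ofPred_eq]
    simp only [h, true_and]
    omega
  · simp [height_of_not_reachable h, SimpleGraph.gBall, h]

theorem height_self : height G c r c = r + 1 := by
  simp [height_of_reachable (SimpleGraph.Reachable.refl c)]

theorem height_le : height G c r u ≤ r + 1 := by
  unfold height
  split_ifs <;> omega

theorem height_lipschitz (h : G.Adj u v) : height G c r u ≤ height G c r v + 1 := by
  by_cases hu : G.Reachable c u
  · have hv : G.Reachable c v := hu.trans h.reachable
    rw [height_of_reachable hu, height_of_reachable hv]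
    have h1 := h.reachable.dist_triangle_right c
    rw [SimpleGraph.dist_eq_one_iff_adj.2 h] at h1
    have h2 := h.symm.reachable.dist_triangle_right c
    rw [SimpleGraph.dist_eq_one_iff_adj.2 h.symm] at h2
    omega
  · simp [height_of_not_reachable hu]

theorem height_climb (hu : 0 < height G c r u) (hne : u ≠ c) :
    ∃ v, G.Adj u v ∧ height G c r v = height G c r u + 1 := by
  have hr := reachable_of_height_pos hu
  obtain ⟨p, hp⟩ := hr.symm.exists_walk_length_eq_dist
  cases p with
  | nil => exact absurd rfl hne
  | @cons _ v _ huv p =>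
    refine ⟨v, huv, ?_⟩
    have hv : G.Reachable c v := hr.trans huv.reachable
    rw [SimpleGraph.Walk.length_cons, SimpleGraph.dist_comm] at hp
    have h1 := SimpleGraph.dist_le p
    rw [SimpleGraph.dist_comm] at h1
    have h2 := huv.symm.reachable.dist_triangle_right c
    rw [SimpleGraph.dist_eq_one_iff_adj.2 huv.symm] at h2
    rw [height_of_reachable hr] at hu ⊢
    rw [height_of_reachable hv]
    omega

theorem isPeakFamily_height {ι : Type*} {c : ι → V} {r : ι → ℕ}
    (h : ∀ i j, i ≠ j → height G (c j) (r j) (c i) < r i + 1) :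
    IsPeakFamily G c fun i => height G (c i) (r i) where
  lipschitz _ _ _ hab := height_lipschitz hab
  climb _ _ ha hne := height_climb ha hne
  le_peak _ _ := by
    rw [height_self]
    exact height_le
  peak_pos _ := by
    rw [height_self]
    omega
  dominant i j hij := by
    rw [height_self]
    exact h i j hij

/-- The heights of an antichain of balls form a peak family. -/
theorem isPeakFamily_of_antichain {ι : Type*} {c : ι → V} {r : ι → ℕ}
    (h : ∀ i j, i ≠ j → ¬ G.gBall (c i) (r i) ⊆ G.gBall (c j) (r j)) :
    IsPeakFamily G c fun i => height G (c i) (r i) := by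
  refine isPeakFamily_height fun i j hij => ?_
  by_contra! hle
  refine h i j hij fun u hu => ?_
  have hji : G.Reachable (c j) (c i) := reachable_of_height_pos (r := r j) (by omega)
  rw [height_of_reachable hji] at hle
  refine ⟨hji.trans hu.1, ?_⟩
  have h1 := hji.dist_triangle_left u
  have h2 := hu.2
  omega

/-- The heights of distinct points for a common radius form a peak family. -/
theorem isPeakFamily_of_injective {ι : Type*} {c : ι → V} (hc : Function.Injective c) (r : ℕ) :
    IsPeakFamily G c fun i => height G (c i) r := by
  refine isPeakFamily_height (r := fun _ => r) fun i j hij => ?_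
  by_cases h : G.Reachable (c j) (c i)
  · rw [height_of_reachable h]
    have := h.pos_dist_of_ne (hc.ne hij.symm)
    omega
  · rw [height_of_not_reachable h]
    omega

theorem dist_lt_card [Fintype V] (h : G.Reachable u v) : G.dist u v < Fintype.card V := by
  obtain ⟨p, hp, hlen⟩ := h.exists_path_of_dist
  rw [← hlen]
  exact hp.length_lt

end Height

/-- The contact graph of Voronoi cells is sparse in a graph without `K₅` minor. -/
theorem IsPeakFamily.card_adjPairs_contactGraph_le {ι V : Type*} [Fintype ι] {G : SimpleGraph V}
    {x : ι → V} {g : ι → V → ℕ} (hg : IsPeakFamily G x g) {rk : ι → ℕ}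
    (hrk : Function.Injective rk) (hG : ¬ HasK5MinorIn G Set.univ) (S : Finset ι) :
    (adjPairs (contactGraph G rk g (S : Set ι))).card ≤ 6 * S.card := by
  by_contra! hlt
  have hpos : 0 < (adjPairs (contactGraph G rk g (S : Set ι))).card := by omega
  obtain ⟨p, hp⟩ := Finset.card_pos.1 hpos
  have hpS : p.1 ∈ S := (mem_adjPairs.1 hp).2.1
  exact hG (hg.hasK5MinorIn_of_contactGraph hrk (hasK5MinorIn_of_card_le _ S
    (fun a b hab => hab.2.1) (Finset.card_pos.2 ⟨_, hpS⟩) (by omega)))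

/-- In a graph without `K₅` minor, balls cannot cut out all pairs from a set of five vertices. -/
theorem not_forall_pair_cut {V : Type*} [Fintype V] {G : SimpleGraph V}
    (hG : ¬ HasK5MinorIn G Set.univ) (x : Fin 5 → V) (hx : Function.Injective x) :
    ¬ ∀ i j, i ≠ j → ∃ c r, ∀ l, x l ∈ G.gBall c r ↔ l = i ∨ l = j := by
  intro h
  have hg := isPeakFamily_of_injective (G := G) hx (Fintype.card V)
  have hadj : ∀ i j, i ≠ j → (contactGraph G Fin.val (fun i => height G (x i) (Fintype.card V))
      Set.univ).Adj i j := by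
    intro i j hij
    obtain ⟨c, r, hc⟩ := h i j hij
    have hpos : ∀ l, l = i ∨ l = j → 0 < height G (x l) (Fintype.card V) c ∧
        ∀ m, m ≠ i → m ≠ j →
          height G (x m) (Fintype.card V) c < height G (x l) (Fintype.card V) c := by
      intro l hl
      obtain ⟨h1, h2⟩ := (hc l).2 hl
      have h3 := dist_lt_card h1
      rw [SimpleGraph.dist_comm] at h2 h3
      rw [height_of_reachable h1.symm]
      refine ⟨by omega, fun m hmi hmj => ?_⟩
      by_cases hm : G.Reachable (x m) c
      · have hm' : ¬ G.dist c (x m) ≤ r := fun hle => by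
          rcases (hc m).1 ⟨hm.symm, hle⟩ with h | h
          exacts [hmi h, hmj h]
        have h4 := dist_lt_card hm
        rw [SimpleGraph.dist_comm] at hm'
        rw [height_of_reachable hm]
        omega
      · rw [height_of_not_reachable hm]
        omega
    exact hg.contactGraph_adj_of_top_two hij (Set.mem_univ _) (Set.mem_univ _)
      (fun l h1 h2 => ⟨(hpos i (Or.inl rfl)).2 l h1 h2, (hpos j (Or.inr rfl)).2 l h1 h2⟩)
      (hpos i (Or.inl rfl)).1 (hpos j (Or.inr rfl)).1
  refine hG (hg.hasK5MinorIn_of_contactGraph Fin.val_injective ⟨fun i => {i},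
    fun _ => Set.subset_univ _, fun i => connected_induce_singleton _ i, fun i j hij => ?_,
    fun i j hij => ⟨i, rfl, j, rfl, hadj i j hij⟩⟩)
  simpa using hij

/-- The probability that the random subset of `ι` containing each `i` independently with
probability `p i` equals `S`. -/
noncomputable def bernoulliWeight {ι : Type*} [Fintype ι] [DecidableEq ι] (p : ι → ℝ)
    (S : Finset ι) : ℝ :=
  (∏ i ∈ S, p i) * ∏ i ∈ Sᶜ, (1 - p i)

section Bernoulli

variable {ι : Type*} [Fintype ι] [DecidableEq ι]

theorem bernoulliWeight_nonneg {p : ι → ℝ} (h0 : ∀ i, 0 ≤ p i) (h1 : ∀ i, p i ≤ 1)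
    (S : Finset ι) : 0 ≤ bernoulliWeight p S :=
  mul_nonneg (Finset.prod_nonneg fun i _ => h0 i)
    (Finset.prod_nonneg fun i _ => sub_nonneg.2 (h1 i))

/-- The probability that a random subset contains `R` and avoids `C`. -/
theorem sum_bernoulliWeight {p : ι → ℝ} {R C : Finset ι} (hRC : Disjoint R C) :
    ∑ S, (if R ⊆ S ∧ Disjoint S C then bernoulliWeight p S else 0) =
      (∏ i ∈ R, p i) * ∏ i ∈ C, (1 - p i) := by
  have h := Fintype.prod_add (fun i => if i ∈ C then 0 else p i)
    (fun i => if i ∈ R then 0 else 1 - p i)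
  have hl : ∏ i, ((if i ∈ C then 0 else p i) + (if i ∈ R then 0 else 1 - p i)) =
      (∏ i ∈ R, p i) * ∏ i ∈ C, (1 - p i) := by
    rw [← Finset.prod_subset (Finset.subset_univ (R ∪ C)), Finset.prod_union hRC]
    · congr 1
      · refine Finset.prod_congr rfl fun i hi => ?_
        simp [hi, Finset.disjoint_left.1 hRC hi]
      · refine Finset.prod_congr rfl fun i hi => ?_
        simp [hi, Finset.disjoint_right.1 hRC hi]
    · intro i _ hi
      simp only [Finset.mem_union, not_or] at hi
      simp [hi]
  rw [← hl, h]
  refine Finset.sum_congr rfl fun S _ => ?_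
  split_ifs with hS
  · rw [bernoulliWeight]
    congr 1
    · refine Finset.prod_congr rfl fun i hi => ?_
      rw [if_neg (Finset.disjoint_left.1 hS.2 hi)]
    · refine Finset.prod_congr rfl fun i hi => ?_
      rw [if_neg fun hR => Finset.mem_compl.1 hi (hS.1 hR)]
  · symm
    rw [not_and_or, Finset.not_subset, Finset.not_disjoint_iff] at hS
    rcases hS with ⟨i, hiR, hiS⟩ | ⟨i, hiS, hiC⟩
    · exact mul_eq_zero_of_right _
        (Finset.prod_eq_zero (i := i) (by simpa using hiS) (by simp [hiR]))
    · exact mul_eq_zero_of_left (Finset.prod_eq_zero (i := i) hiS (by simp [hiC])) _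

/-- The expected size of a random subset. -/
theorem sum_bernoulliWeight_mul_card (p : ι → ℝ) :
    ∑ S, bernoulliWeight p S * (S.card : ℝ) = ∑ i, p i := by
  have h : ∀ S : Finset ι, bernoulliWeight p S * (S.card : ℝ) =
      ∑ i, if ({i} : Finset ι) ⊆ S ∧ Disjoint S ∅ then bernoulliWeight p S else 0 := by
    intro S
    simp [mul_comm]
  simp_rw [h]
  rw [Finset.sum_comm]
  refine Finset.sum_congr rfl fun i _ => ?_
  rw [sum_bernoulliWeight (Finset.disjoint_empty_right _)]
  simp

/-- The **Clarkson–Shor** sampling argument: if in each sample `S` the number of pairs of `Q` inside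
`S` whose conflict sets avoid `S` is linear in the size of `S`, then the corresponding
expectations satisfy the same inequality. -/
theorem sum_prod_conflict_le {p : ι → ℝ} (h0 : ∀ i, 0 ≤ p i) (h1 : ∀ i, p i ≤ 1)
    {k : ℕ} {Q : Finset (ι × ι)} {C : ι × ι → Finset ι} (hne : ∀ q ∈ Q, q.1 ≠ q.2)
    (hC : ∀ q ∈ Q, q.1 ∉ C q ∧ q.2 ∉ C q)
    (hQ : ∀ S : Finset ι, (Q.filter fun q => {q.1, q.2} ⊆ S ∧ Disjoint S (C q)).card ≤
      k * S.card) :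
    ∑ q ∈ Q, p q.1 * p q.2 * ∏ i ∈ C q, (1 - p i) ≤ k * ∑ i, p i := by
  have h : ∀ q ∈ Q, p q.1 * p q.2 * ∏ i ∈ C q, (1 - p i) =
      ∑ S, (if {q.1, q.2} ⊆ S ∧ Disjoint S (C q) then bernoulliWeight p S else 0) := by
    intro q hq
    rw [sum_bernoulliWeight, Finset.prod_pair (hne q hq)]
    simpa using hC q hq
  rw [Finset.sum_congr rfl h, Finset.sum_comm, ← sum_bernoulliWeight_mul_card p,
    Finset.mul_sum]
  refine Finset.sum_le_sum fun S _ => ?_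
  have hc : ((Q.filter fun q => {q.1, q.2} ⊆ S ∧ Disjoint S (C q)).card : ℝ) ≤ k * S.card := by
    exact_mod_cast hQ S
  have := mul_le_mul_of_nonneg_right hc (bernoulliWeight_nonneg h0 h1 S)
  rw [← Finset.sum_filter, Finset.sum_const, nsmul_eq_mul]
  linarith

theorem sum_mul_le_of_conflict {w : ι → ℝ} (hw : ∀ i, 0 ≤ w i)
    {k : ℕ} {Q : Finset (ι × ι)} {C : ι × ι → Finset ι} (hne : ∀ q ∈ Q, q.1 ≠ q.2)
    (hC : ∀ q ∈ Q, q.1 ∉ C q ∧ q.2 ∉ C q)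
    (hload : ∀ q ∈ Q, w q.1 + w q.2 + ∑ i ∈ C q, w i ≤ 1)
    (hQ : ∀ S : Finset ι, (Q.filter fun q => {q.1, q.2} ⊆ S ∧ Disjoint S (C q)).card ≤
      k * S.card) :
    ∑ q ∈ Q, w q.1 * w q.2 ≤ k * Real.exp 1 * ∑ i, w i := by
  have hp := sum_prod_conflict_le (p := fun i => 1 - Real.exp (-w i))
    (fun i => by
      have := Real.exp_le_one_iff.2 (neg_nonpos.2 (hw i))
      linarith)
    (fun i => by
      have := Real.exp_pos (-w i)
      linarith) hne hC hQ
  have hlow : ∀ i, w i * Real.exp (-w i) ≤ 1 - Real.exp (-w i) := by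
    intro i
    have h1 := Real.add_one_le_exp (w i)
    have h2 : Real.exp (w i) * Real.exp (-w i) = 1 := by
      rw [← Real.exp_add]
      simp
    nlinarith [Real.exp_pos (-w i)]
  have hup : ∑ i, (1 - Real.exp (-w i)) ≤ ∑ i, w i := by
    refine Finset.sum_le_sum fun i _ => ?_
    have := Real.add_one_le_exp (-w i)
    linarith
  have hterm : ∀ q ∈ Q, Real.exp (-1) * (w q.1 * w q.2) ≤
      (1 - Real.exp (-w q.1)) * (1 - Real.exp (-w q.2)) *
        ∏ i ∈ C q, (1 - (1 - Real.exp (-w i))) := by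
    intro q hq
    have h1 : ∏ i ∈ C q, (1 - (1 - Real.exp (-w i))) = Real.exp (-∑ i ∈ C q, w i) := by
      rw [← Finset.sum_neg_distrib, Real.exp_sum]
      exact Finset.prod_congr rfl fun i _ => by ring
    rw [h1]
    calc Real.exp (-1) * (w q.1 * w q.2)
        ≤ Real.exp (-w q.1 + -w q.2 + -∑ i ∈ C q, w i) * (w q.1 * w q.2) := by
          have := hload q hq
          have := mul_nonneg (hw q.1) (hw q.2)
          gcongr
          linarith
      _ = (w q.1 * Real.exp (-w q.1)) * (w q.2 * Real.exp (-w q.2)) *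
            Real.exp (-∑ i ∈ C q, w i) := by
          rw [Real.exp_add, Real.exp_add]
          ring
      _ ≤ _ := by
          have := mul_nonneg (hw q.2) (Real.exp_pos (-w q.2)).le
          have h3 := (mul_nonneg (hw q.1) (Real.exp_pos (-w q.1)).le).trans (hlow q.1)
          gcongr
          exacts [hlow q.1, hlow q.2]
  have hsum : Real.exp (-1) * ∑ q ∈ Q, w q.1 * w q.2 ≤ k * ∑ i, w i := by
    rw [Finset.mul_sum]
    refine (Finset.sum_le_sum hterm).trans (hp.trans ?_)
    gcongr
  calc ∑ q ∈ Q, w q.1 * w q.2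
      = Real.exp 1 * (Real.exp (-1) * ∑ q ∈ Q, w q.1 * w q.2) := by
        rw [← mul_assoc, ← Real.exp_add]
        simp
    _ ≤ Real.exp 1 * (k * ∑ i, w i) := by gcongr
    _ = _ := by ring

end Bernoulli

/-- A greedy Turán-type bound: if all weightings in which every vertex has load at most one have few
weighted intersecting pairs, then every such weighting is dominated by a packing. -/
theorem exists_packing {ι V : Type*} [Fintype ι] [DecidableEq ι] {B : ι → Set V}
    (hB : ∀ i, (B i).Nonempty) {c : ℝ}
    (H : ∀ w : ι → ℝ, (∀ i, 0 ≤ w i) → (∀ v, ∑ i, (B i).indicator (fun _ => w i) v ≤ 1) →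
      ∑ i, w i * (∑ j, open Classical in if Disjoint (B i) (B j) then 0 else w j) ≤ c * ∑ i, w i)
    (w : ι → ℝ) (hw : ∀ i, 0 ≤ w i) (hload : ∀ v, ∑ i, (B i).indicator (fun _ => w i) v ≤ 1) :
    ∃ M : Finset ι, (∀ i ∈ M, w i ≠ 0) ∧ (∀ i ∈ M, ∀ j ∈ M, i ≠ j → Disjoint (B i) (B j)) ∧
      ∑ i, w i ≤ c * M.card := by
  classical
  obtain ⟨n, hn⟩ : ∃ n, (Finset.univ.filter fun i => w i ≠ 0).card = n := ⟨_, rfl⟩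
  induction n using Nat.strong_induction_on generalizing w with
  | _ n ih =>
  by_cases hz : ∀ i, w i = 0
  · exact ⟨∅, by simp, by simp, by simp [hz]⟩
  push Not at hz
  obtain ⟨i, hi, hic⟩ : ∃ i, w i ≠ 0 ∧ (∑ j, if Disjoint (B i) (B j) then 0 else w j) ≤ c := by
    by_contra! hcon
    have h1 := H w hw hload
    rw [Finset.mul_sum] at h1
    refine absurd h1 (not_le.2 (Finset.sum_lt_sum (fun i _ => ?_) ?_))
    · by_cases h : w i = 0
      · simp [h]
      · rw [mul_comm]
        exact mul_le_mul_of_nonneg_left (hcon i h).le (hw i)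
    · obtain ⟨i, hi⟩ := hz
      refine ⟨i, Finset.mem_univ i, ?_⟩
      rw [mul_comm]
      exact mul_lt_mul_of_pos_left (hcon i hi) ((hw i).lt_of_ne' hi)
  have hself : ¬ Disjoint (B i) (B i) := by
    rw [disjoint_self]
    exact (hB i).ne_empty
  set w' : ι → ℝ := fun j => if Disjoint (B i) (B j) then w j else 0 with hw'
  have hw'0 : ∀ j, 0 ≤ w' j := fun j => by
    simp only [hw']
    split_ifs
    exacts [hw j, le_rfl]
  have hw'le : ∀ j, w' j ≤ w j := fun j => by
    simp only [hw']
    split_ifs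
    exacts [le_rfl, hw j]
  have hlt : (Finset.univ.filter fun j => w' j ≠ 0).card < n := by
    rw [← hn]
    apply Finset.card_lt_card
    rw [Finset.ssubset_iff_of_subset]
    · exact ⟨i, by simpa using hi, by simp [hw', (hB i).ne_empty]⟩
    · intro j
      simp only [Finset.mem_filter, Finset.mem_univ, true_and, hw']
      split_ifs <;> simp
  obtain ⟨M, hM1, hM2, hM3⟩ := ih _ hlt w' hw'0 (fun v => (Finset.sum_le_sum fun j _ => by
    by_cases hv : v ∈ B j <;> simp [hv, hw'le j]).trans (hload v)) rfl
  have hMi : ∀ j ∈ M, Disjoint (B i) (B j) ∧ w j ≠ 0 := by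
    intro j hj
    have := hM1 j hj
    simp only [hw'] at this
    split_ifs at this with h
    exacts [⟨h, this⟩, absurd rfl this]
  have hiM : i ∉ M := fun h => hself (hMi i h).1
  refine ⟨insert i M, ?_, ?_, ?_⟩
  · intro j hj
    rcases Finset.mem_insert.1 hj with rfl | hj
    exacts [hi, (hMi j hj).2]
  · intro j hj k hk hjk
    rcases Finset.mem_insert.1 hj with hj' | hj' <;> rcases Finset.mem_insert.1 hk with hk' | hk'
    · exact absurd (hj'.trans hk'.symm) hjk
    · exact hj' ▸ (hMi k hk').1
    · exact hk' ▸ (hMi j hj').1.symm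
    · exact hM2 j hj' k hk' hjk
  · have hsplit : ∑ j, w j = ∑ j, w' j + ∑ j, if Disjoint (B i) (B j) then 0 else w j := by
      rw [← Finset.sum_add_distrib]
      refine Finset.sum_congr rfl fun j _ => ?_
      simp only [hw']
      split_ifs <;> simp
    rw [hsplit, Finset.card_insert_of_notMem hiM]
    push_cast
    linarith

theorem mem_gBall_self {V : Type*} (G : SimpleGraph V) (c : V) (r : ℕ) : c ∈ G.gBall c r :=
  ⟨SimpleGraph.Reachable.refl c, by simp⟩

/-- In an antichain of balls of a graph without a `K₅` minor, a weighting in which every vertex has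
load at most one is dominated by a packing. -/
theorem exists_packing_of_antichain {ι V : Type*} [Fintype ι] {G : SimpleGraph V}
    (hG : ¬ HasK5MinorIn G Set.univ) {c : ι → V} {r : ι → ℕ}
    (hanti : ∀ i j, i ≠ j → ¬ G.gBall (c i) (r i) ⊆ G.gBall (c j) (r j))
    (w : ι → ℝ) (hw : ∀ i, 0 ≤ w i)
    (hload : ∀ v, ∑ i, (G.gBall (c i) (r i)).indicator (fun _ => w i) v ≤ 1) :
    ∃ M : Finset ι,
      (∀ i ∈ M, ∀ j ∈ M, i ≠ j → Disjoint (G.gBall (c i) (r i)) (G.gBall (c j) (r j))) ∧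
      ∑ i, w i ≤ 18 * M.card := by
  classical
  have hg := isPeakFamily_of_antichain hanti
  suffices H : ∀ w : ι → ℝ, (∀ i, 0 ≤ w i) →
      (∀ v, ∑ i, (G.gBall (c i) (r i)).indicator (fun _ => w i) v ≤ 1) →
      ∑ i, w i * (∑ j, if Disjoint (G.gBall (c i) (r i)) (G.gBall (c j) (r j)) then 0 else w j) ≤
        18 * ∑ i, w i by
    obtain ⟨M, -, hM1, hM2⟩ := exists_packing (B := fun i => G.gBall (c i) (r i))
      (fun i => ⟨c i, mem_gBall_self G _ _⟩) (c := 18) (fun w hw hl => by convert H w hw hl)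
      w hw hload
    exact ⟨M, hM1, hM2⟩
  clear hload hw w
  intro w hw hload
  obtain ⟨rk, hrk⟩ := Countable.exists_injective_nat ι
  set Q : Finset (ι × ι) := Finset.univ.filter fun q =>
    q.1 ≠ q.2 ∧ ¬ Disjoint (G.gBall (c q.1) (r q.1)) (G.gBall (c q.2) (r q.2)) with hQ
  have hcontact : ∀ q : ι × ι, ∃ v, q ∈ Q →
      v ∈ G.gBall (c q.1) (r q.1) ∧ v ∈ G.gBall (c q.2) (r q.2) ∧
      ∀ S : Set ι, q.1 ∈ S → q.2 ∈ S →
        (∀ l ∈ S, v ∈ G.gBall (c l) (r l) → l = q.1 ∨ l = q.2) →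
        (contactGraph G rk (fun i => height G (c i) (r i)) S).Adj q.1 q.2 := by
    intro q
    by_cases hq : q ∈ Q
    · simp only [hQ, Finset.mem_filter, Finset.mem_univ, true_and] at hq
      obtain ⟨z, hz1, hz2⟩ := Set.not_disjoint_iff.1 hq.2
      obtain ⟨v, hv⟩ := hg.exists_contact (rk := rk) hq.1
        ⟨z, height_pos_iff.2 hz1, height_pos_iff.2 hz2⟩
      simp only [height_pos_iff] at hv
      exact ⟨v, fun _ => hv⟩
    · exact ⟨c q.1, fun h => absurd h hq⟩
  choose v hv using hcontact
  have hsum := sum_mul_le_of_conflict hw (k := 6) (Q := Q)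
    (C := fun q => Finset.univ.filter fun l => l ≠ q.1 ∧ l ≠ q.2 ∧ v q ∈ G.gBall (c l) (r l))
    (fun q hq => by simp [hQ] at hq; exact hq.1) (fun q hq => by simp) ?_ ?_
  · have hdiag : ∀ i, w i ≤ 1 := by
      intro i
      refine le_trans ?_ (hload (c i))
      have := Finset.single_le_sum (f := fun j =>
        (G.gBall (c j) (r j)).indicator (fun _ => w j) (c i))
        (fun j _ => Set.indicator_nonneg (fun _ _ => hw j) _) (Finset.mem_univ i)
      simpa [mem_gBall_self] using this
    have hsplit : ∑ i, w i * (∑ j, if Disjoint (G.gBall (c i) (r i)) (G.gBall (c j) (r j))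
        then 0 else w j) ≤ ∑ i, w i * w i + ∑ q ∈ Q, w q.1 * w q.2 := by
      rw [hQ, Finset.sum_filter, Fintype.sum_prod_type, ← Finset.sum_add_distrib]
      refine Finset.sum_le_sum fun i _ => ?_
      rw [Finset.mul_sum, ← Finset.sum_erase_add _ _ (Finset.mem_univ i), add_comm]
      refine add_le_add ?_ ?_
      · split_ifs
        · simpa using mul_nonneg (hw i) (hw i)
        · exact le_rfl
      · rw [← Finset.sum_erase_add (a := i) (s := Finset.univ) _ (Finset.mem_univ i)]
        simp only [ne_eq, not_true_eq_false, false_and, if_false, add_zero]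
        refine Finset.sum_le_sum fun j hj => ?_
        have hij : i ≠ j := (Finset.ne_of_mem_erase hj).symm
        by_cases hd : Disjoint (G.gBall (c i) (r i)) (G.gBall (c j) (r j)) <;> simp [hij, hd]
    have hsq : ∑ i, w i * w i ≤ ∑ i, w i :=
      Finset.sum_le_sum fun i _ => mul_le_of_le_one_left (hw i) (hdiag i)
    have hnn : 0 ≤ ∑ i, w i := Finset.sum_nonneg fun i _ => hw i
    have he := Real.exp_one_lt_d9
    have : ((6 : ℕ) : ℝ) * Real.exp 1 * ∑ i, w i ≤ 17 * ∑ i, w i := by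
      gcongr
      push_cast
      linarith
    linarith
  · intro q hq
    obtain ⟨h1, h2, -⟩ := hv q hq
    have hne : q.1 ≠ q.2 := (Finset.mem_filter.1 hq).2.1
    refine le_trans (le_of_eq ?_) (hload (v q))
    rw [← Finset.sum_pair hne, ← Finset.sum_union]
    · simp only [Set.indicator_apply]
      rw [← Finset.sum_filter]
      refine Finset.sum_congr ?_ fun _ _ => rfl
      ext l
      simp only [Finset.mem_union, Finset.mem_insert, Finset.mem_singleton, Finset.mem_filter,
        Finset.mem_univ, true_and]
      constructor
      · rintro ((rfl | rfl) | h)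
        exacts [h1, h2, h.2.2]
      · intro h
        by_cases hl1 : l = q.1
        · exact Or.inl (Or.inl hl1)
        by_cases hl2 : l = q.2
        · exact Or.inl (Or.inr hl2)
        exact Or.inr ⟨hl1, hl2, h⟩
    · rw [Finset.disjoint_left]
      intro l hl hl'
      simp only [Finset.mem_insert, Finset.mem_singleton, Finset.mem_filter,
        Finset.mem_univ, true_and] at hl hl'
      tauto
  · intro S
    refine le_trans (Finset.card_le_card ?_) (hg.card_adjPairs_contactGraph_le hrk hG S)
    intro q hq
    obtain ⟨hqQ, hqS, hqd⟩ := Finset.mem_filter.1 hq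
    rw [mem_adjPairs]
    refine (hv q hqQ).2.2 _ (hqS (by simp)) (hqS (by simp)) fun l hl hlv => ?_
    by_contra! hcon
    exact Finset.disjoint_left.1 hqd hl (by simp [hcon, hlv])

/-- **Linear programming duality** for fractional matchings and fractional transversals: if every
fractional matching has total weight at most `t`, then some probability weight gives weight at
least `1 / t` to each edge. -/
theorem exists_fractional_transversal {ι V : Type*} [Fintype ι] [Fintype V] [Nonempty V]
    (B : ι → Set V) {t : ℝ} (ht : 0 < t)
    (H : ∀ w : ι → ℝ, (∀ i, 0 ≤ w i) → (∀ v, ∑ i, (B i).indicator (fun _ => w i) v ≤ 1) →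
      ∑ i, w i ≤ t) :
    ∃ μ ∈ stdSimplex ℝ V, ∀ i, 1 / t ≤ ∑ v, (B i).indicator μ v := by
  classical
  let T : (V → ℝ) →ₗ[ℝ] (ι → ℝ) :=
    { toFun := fun μ i => ∑ v, (B i).indicator μ v
      map_add' := fun μ ν => by
        ext i
        simp only [Pi.add_apply, ← Finset.sum_add_distrib]
        exact Finset.sum_congr rfl fun v _ => congrFun (Set.indicator_add (B i) μ ν) v
      map_smul' := fun a μ => by
        ext i
        simp only [Pi.smul_apply, smul_eq_mul, RingHom.id_apply, Finset.mul_sum]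
        exact Finset.sum_congr rfl fun v _ => congrFun (Set.indicator_const_smul (B i) a μ) v }
  have hT : ∀ μ i, T μ i = ∑ v, (B i).indicator μ v := fun _ _ => rfl
  by_contra! hcon
  have hdisj : Disjoint (T '' stdSimplex ℝ V) {y : ι → ℝ | ∀ i, 1 / t ≤ y i} := by
    rw [Set.disjoint_left]
    rintro _ ⟨μ, hμ, rfl⟩ hy
    obtain ⟨i, hi⟩ := hcon μ hμ
    exact absurd (hy i) (not_le.2 hi)
  have hclosed : IsClosed {y : ι → ℝ | ∀ i, 1 / t ≤ y i} := by
    simp only [Set.ofPred_forall]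
    exact isClosed_iInter fun i => isClosed_le continuous_const (continuous_apply i)
  have hconv : Convex ℝ {y : ι → ℝ | ∀ i, 1 / t ≤ y i} := by
    intro x hx y hy a b ha hb hab i
    have h1 := mul_le_mul_of_nonneg_left (hx i) ha
    have h2 := mul_le_mul_of_nonneg_left (hy i) hb
    calc 1 / t = a * (1 / t) + b * (1 / t) := by rw [← add_mul, hab, one_mul]
      _ ≤ a * x i + b * y i := add_le_add h1 h2
      _ = (a • x + b • y) i := by simp
  obtain ⟨f, u, v, hfu, huv, hfv⟩ := geometric_hahn_banach_compact_closed
    ((convex_stdSimplex ℝ V).linear_image T)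
    ((isCompact_stdSimplex ℝ V).image T.continuous_of_finiteDimensional) hconv hclosed hdisj
  set w : ι → ℝ := fun i => f (Pi.single i 1) with hwdef
  have hf : ∀ y : ι → ℝ, f y = ∑ i, y i * w i := by
    intro y
    conv_lhs => rw [pi_eq_sum_univ' y]
    simp [map_sum, hwdef]
  have hw : ∀ i, 0 ≤ w i := by
    intro i
    by_contra! hneg
    have h1 := hfv ((fun _ => 1 / t) + (|v - f fun _ => 1 / t| / -w i) • Pi.single i 1) (by
      intro j
      have : 0 ≤ |v - f fun _ => 1 / t| / -w i := div_nonneg (abs_nonneg _) (by linarith)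
      have h2 : 0 ≤ (Pi.single i (1 : ℝ) : ι → ℝ) j := by
        rw [Pi.single_apply]
        split_ifs <;> norm_num
      simpa using mul_nonneg this h2)
    rw [map_add, map_smul, smul_eq_mul] at h1
    change v < _ + _ * w i at h1
    have h3 : |v - f fun _ => 1 / t| / -w i * w i = -|v - f fun _ => 1 / t| := by
      rw [div_neg, neg_mul, div_mul_cancel₀ _ hneg.ne]
    rw [h3] at h1
    have := neg_abs_le (v - f fun _ => 1 / t)
    linarith
  have hload : ∀ x, ∑ i, (B i).indicator (fun _ => w i) x < u := by
    intro x
    have h1 := hfu _ (Set.mem_image_of_mem T (single_mem_stdSimplex ℝ x))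
    rw [hf] at h1
    convert h1 using 2 with i
    rw [hT, Finset.sum_eq_single x]
    · by_cases hx : x ∈ B i <;> simp [hx]
    · intro y _ hy
      by_cases hyB : y ∈ B i <;> simp [hyB, hy]
    · simp
  have hu : 0 < u := by
    obtain ⟨x⟩ := ‹Nonempty V›
    exact (Finset.sum_nonneg fun i _ => Set.indicator_nonneg (fun _ _ => hw i) x).trans_lt (hload x)
  have h1 := H (fun i => w i / u) (fun i => div_nonneg (hw i) hu.le) (fun x => by
    have h2 : ∑ i, (B i).indicator (fun _ => w i / u) x =
        (∑ i, (B i).indicator (fun _ => w i) x) / u := by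
      rw [Finset.sum_div]
      refine Finset.sum_congr rfl fun i _ => ?_
      by_cases hx : x ∈ B i <;> simp [hx]
    rw [h2]
    exact (div_le_one hu).2 (hload x).le)
  rw [← Finset.sum_div, div_le_iff₀ hu] at h1
  have h2 := hfv (fun _ => 1 / t) (fun _ => le_rfl)
  rw [hf, ← Finset.mul_sum] at h2
  have h3 : 1 / t * ∑ i, w i ≤ 1 / t * (t * u) := by gcongr
  rw [← mul_assoc, one_div_mul_cancel ht.ne', one_mul] at h3
  linarith

/-- The **Sauer–Shelah lemma** for traces. -/
theorem card_image_inter_le {α : Type*} [DecidableEq α] {𝒜 : Finset (Finset α)} {d : ℕ}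
    (hd : ∀ s, 𝒜.Shatters s → s.card ≤ d) (Z : Finset α) :
    (𝒜.image fun b => Z ∩ b).card ≤ ∑ k ∈ Finset.range (d + 1), Z.card.choose k := by
  refine (Finset.card_le_card_shatterer _).trans ?_
  have hsub : (𝒜.image fun b => Z ∩ b).shatterer ⊆
      (Finset.range (d + 1)).biUnion fun k => Z.powersetCard k := by
    intro s hs
    rw [Finset.mem_shatterer] at hs
    have hsZ : s ⊆ Z := by
      obtain ⟨t, ht, hst⟩ := hs.exists_superset
      obtain ⟨b, -, rfl⟩ := Finset.mem_image.1 ht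
      exact hst.trans Finset.inter_subset_left
    have hcard : s.card ≤ d := by
      refine hd s fun u hu => ?_
      obtain ⟨t, ht, hst⟩ := hs hu
      obtain ⟨b, hb, rfl⟩ := Finset.mem_image.1 ht
      refine ⟨b, hb, ?_⟩
      rw [← hst, ← Finset.inter_assoc, Finset.inter_eq_left.2 hsZ]
    simp only [Finset.mem_biUnion, Finset.mem_range, Finset.mem_powersetCard]
    exact ⟨s.card, by omega, hsZ, rfl⟩
  refine (Finset.card_le_card hsub).trans (Finset.card_biUnion_le.trans ?_)
  simp

/-- The **ε-net theorem** of Haussler and Welzl, by double sampling. -/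
theorem exists_net {V : Type*} [Fintype V] [DecidableEq V] {μ : V → ℝ} (hμ : μ ∈ stdSimplex ℝ V)
    {𝒜 : Finset (Finset V)} {d : ℕ} (hd : ∀ s, 𝒜.Shatters s → s.card ≤ d) {ε : ℝ} (hε : 0 ≤ ε)
    (h𝒜 : ∀ b ∈ 𝒜, ε ≤ ∑ v ∈ b, μ v) {N : ℕ}
    (hN : ((∑ k ∈ Finset.range (d + 1), (2 * N).choose k : ℕ) : ℝ) < (1 + ε) ^ N) :
    ∃ x : Fin N → V, ∀ b ∈ 𝒜, ∃ i, x i ∈ b := by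
  obtain ⟨hμ0, hμ1⟩ := hμ
  by_contra! hcon
  choose D hD𝒜 hD using hcon
  set W : (Fin N → V × V) → ℝ := fun z => ∏ i, μ (z i).1 * μ (z i).2 with hW
  set F : (Fin N → V × V) → ℝ := fun z =>
    ∏ i, (1 + if (z i).2 ∈ D fun i => (z i).1 then 1 else 0) with hF
  have hW0 : ∀ z, 0 ≤ W z := fun z => Finset.prod_nonneg fun i _ => mul_nonneg (hμ0 _) (hμ0 _)
  have hW1 : ∑ z, W z = 1 := by
    rw [hW, ← Fintype.prod_sum (fun _ : Fin N => fun p : V × V => μ p.1 * μ p.2)]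
    simp [Fintype.sum_prod_type, ← Finset.mul_sum, hμ1]
  have hlow : (1 + ε) ^ N ≤ ∑ z, W z * F z := by
    have h1 : ∑ z, W z * F z = ∑ x : Fin N → V, (∏ i, μ (x i)) *
        ∏ _i : Fin N, (1 + ∑ v ∈ D x, μ v) := by
      rw [← (Equiv.arrowProdEquivProdArrow (Fin N) (fun _ => V) (fun _ => V)).symm.sum_comp,
        Fintype.sum_prod_type]
      refine Finset.sum_congr rfl fun x _ => ?_
      have h2 : (1 + ∑ v ∈ D x, μ v) = ∑ v, μ v * (1 + if v ∈ D x then 1 else 0) := by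
        simp [mul_add, Finset.sum_add_distrib, hμ1]
      rw [h2, Fintype.prod_sum, Finset.mul_sum]
      refine Finset.sum_congr rfl fun y _ => ?_
      simp only [hW, hF, Equiv.arrowProdEquivProdArrow, Equiv.coe_fn_symm_mk,
        Finset.prod_mul_distrib, mul_assoc]
    have h2 : (1 + ε) ^ N = ∑ x : Fin N → V, (∏ i, μ (x i)) * (1 + ε) ^ N := by
      rw [← Finset.sum_mul, ← Fintype.prod_sum (fun _ : Fin N => μ)]
      simp [hμ1]
    rw [h1, h2]
    refine Finset.sum_le_sum fun x _ => ?_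
    refine mul_le_mul_of_nonneg_left ?_ (Finset.prod_nonneg fun i _ => hμ0 _)
    rw [Finset.prod_const, Finset.card_univ, Fintype.card_fin]
    have := h𝒜 _ (hD𝒜 x)
    gcongr
  let sw : Bool → V × V → V × V := fun b p => if b then p.swap else p
  have hsw : ∀ b, Function.Involutive (sw b) := by
    intro b p
    cases b <;> simp [sw]
  have hinv : ∀ σ : Fin N → Bool, ∑ z, W z * F z = ∑ z, W z * F fun i => sw (σ i) (z i) := by
    intro σ
    rw [← (Equiv.piCongrRight fun i => (hsw (σ i)).toPerm).sum_comp]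
    refine Finset.sum_congr rfl fun z _ => ?_
    have : W (fun i => sw (σ i) (z i)) = W z := by
      refine Finset.prod_congr rfl fun i _ => ?_
      by_cases hσ : σ i <;> simp [sw, hσ, mul_comm]
    rw [← this]
    rfl
  have hup : ∀ z : Fin N → V × V, ∑ σ : Fin N → Bool, F (fun i => sw (σ i) (z i)) ≤
      ((∑ k ∈ Finset.range (d + 1), (2 * N).choose k : ℕ) : ℝ) * 2 ^ N := by
    intro z
    set Z : Finset V := Finset.univ.image (fun i => (z i).1) ∪ Finset.univ.image (fun i => (z i).2)
      with hZ
    have hZcard : Z.card ≤ 2 * N := by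
      refine (Finset.card_union_le _ _).trans ?_
      have h1 := Finset.card_image_le (s := Finset.univ) (f := fun i => (z i).1)
      have h2 := Finset.card_image_le (s := Finset.univ) (f := fun i => (z i).2)
      rw [Finset.card_univ, Fintype.card_fin] at h1 h2
      omega
    have hswZ : ∀ b i, (sw b (z i)).1 ∈ Z ∧ (sw b (z i)).2 ∈ Z := by
      intro b i
      cases b <;> simp [sw, hZ]
    set h : Finset V → V × V → ℝ := fun f p =>
      (if p.1 ∈ f then 0 else 1) * (1 + if p.2 ∈ f then 1 else 0) with hh
    have hh0 : ∀ f p, 0 ≤ h f p := by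
      intro f p
      simp only [hh]
      split_ifs <;> norm_num
    calc ∑ σ : Fin N → Bool, F (fun i => sw (σ i) (z i))
        ≤ ∑ σ : Fin N → Bool, ∑ f ∈ 𝒜.image (fun b => Z ∩ b), ∏ i, h f (sw (σ i) (z i)) := by
          refine Finset.sum_le_sum fun σ _ => ?_
          refine le_trans (le_of_eq ?_) (Finset.single_le_sum
            (f := fun f => ∏ i, h f (sw (σ i) (z i)))
            (fun f _ => Finset.prod_nonneg fun i _ => hh0 _ _)
            (Finset.mem_image_of_mem _ (hD𝒜 fun i => (sw (σ i) (z i)).1)))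
          refine Finset.prod_congr rfl fun i _ => ?_
          have h1 := hD (fun i => (sw (σ i) (z i)).1) i
          simp only [hh, Finset.mem_inter, hswZ, true_and, if_neg h1, one_mul]
      _ = ∑ f ∈ 𝒜.image (fun b => Z ∩ b), ∏ i, ∑ b, h f (sw b (z i)) := by
          rw [Finset.sum_comm]
          refine Finset.sum_congr rfl fun f _ => ?_
          rw [Fintype.prod_sum]
      _ ≤ ∑ f ∈ 𝒜.image (fun b => Z ∩ b), (2 : ℝ) ^ N := by
          refine Finset.sum_le_sum fun f _ => ?_
          calc ∏ i, ∑ b, h f (sw b (z i)) ≤ ∏ _i : Fin N, (2 : ℝ) := by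
                refine Finset.prod_le_prod (fun i _ => Finset.sum_nonneg fun b _ => hh0 _ _)
                  fun i _ => ?_
                simp only [Fintype.sum_bool, hh, sw]
                by_cases h1 : (z i).1 ∈ f <;> by_cases h2 : (z i).2 ∈ f <;> norm_num [h1, h2]
            _ = 2 ^ N := by simp
      _ ≤ _ := by
          rw [Finset.sum_const, nsmul_eq_mul]
          gcongr
          refine (card_image_inter_le hd Z).trans ?_
          gcongr
  have h2N : ∑ σ : Fin N → Bool, ∑ z, W z * F (fun i => sw (σ i) (z i)) =
      2 ^ N * ∑ z, W z * F z := by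
    rw [Finset.sum_congr rfl fun σ _ => (hinv σ).symm]
    simp
  have hfin : 2 ^ N * ∑ z, W z * F z ≤
      ((∑ k ∈ Finset.range (d + 1), (2 * N).choose k : ℕ) : ℝ) * 2 ^ N := by
    rw [← h2N, Finset.sum_comm]
    calc ∑ z, ∑ σ : Fin N → Bool, W z * F (fun i => sw (σ i) (z i))
        ≤ ∑ z, W z * (((∑ k ∈ Finset.range (d + 1), (2 * N).choose k : ℕ) : ℝ) * 2 ^ N) := by
          refine Finset.sum_le_sum fun z _ => ?_
          rw [← Finset.mul_sum]
          exact mul_le_mul_of_nonneg_left (hup z) (hW0 z)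
      _ = _ := by rw [← Finset.sum_mul, hW1, one_mul]
  rw [mul_comm] at hfin
  have := le_of_mul_le_mul_right hfin (by positivity)
  linarith

/-- Balls of a graph without a `K₅` minor do not shatter five vertices. -/
theorem card_le_four_of_shatters {V : Type*} [Fintype V] [DecidableEq V] {G : SimpleGraph V}
    (hG : ¬ HasK5MinorIn G Set.univ) {𝒜 : Finset (Finset V)}
    (h𝒜 : ∀ b ∈ 𝒜, ∃ c r, (b : Set V) = G.gBall c r) (s : Finset V) (hs : 𝒜.Shatters s) :
    s.card ≤ 4 := by
  by_contra! h5
  obtain ⟨s', hs's, hcard⟩ := Finset.exists_subset_card_eq (show 5 ≤ s.card from h5)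
  have hs' := hs.mono_right hs's
  let x : Fin 5 → V := fun i => ((s'.equivFinOfCardEq hcard).symm i : V)
  have hx : Function.Injective x :=
    Subtype.val_injective.comp (s'.equivFinOfCardEq hcard).symm.injective
  have hxs : ∀ i, x i ∈ s' := fun i => ((s'.equivFinOfCardEq hcard).symm i).2
  refine not_forall_pair_cut hG x hx fun i j _ => ?_
  obtain ⟨u, hu, hsu⟩ := hs' (show {x i, x j} ⊆ s' by
    intro y hy
    rcases Finset.mem_insert.1 hy with rfl | hy
    · exact hxs i
    · rw [Finset.mem_singleton.1 hy]
      exact hxs j)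
  obtain ⟨c, r, hcr⟩ := h𝒜 u hu
  refine ⟨c, r, fun l => ?_⟩
  have h1 := Finset.ext_iff.1 hsu (x l)
  simp only [Finset.mem_inter, hxs, true_and, Finset.mem_insert, Finset.mem_singleton,
    hx.eq_iff] at h1
  rw [← hcr, Finset.mem_coe, h1]

theorem sum_choose_le_mul_pow {m : ℕ} (hm : 0 < m) (d : ℕ) :
    ∑ k ∈ Finset.range (d + 1), m.choose k ≤ (d + 1) * m ^ d := by
  calc ∑ k ∈ Finset.range (d + 1), m.choose k ≤ ∑ _k ∈ Finset.range (d + 1), m ^ d := by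
        refine Finset.sum_le_sum fun k hk => (Nat.choose_le_pow m k).trans ?_
        exact Nat.pow_le_pow_right hm (Nat.le_of_lt_succ (Finset.mem_range.1 hk))
    _ = _ := by simp

theorem exp_div_le_one_add_pow {t : ℝ} (ht : 0 < t) (N : ℕ) :
    Real.exp (N / (t + 1)) ≤ (1 + 1 / t) ^ N := by
  have h1 := Real.one_sub_le_exp_neg (1 / (t + 1))
  have h2 : 1 - 1 / (t + 1) = t / (t + 1) := by
    field_simp
    ring
  rw [h2, Real.exp_neg] at h1
  have h3 : Real.exp (1 / (t + 1)) ≤ 1 + 1 / t := by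
    have h4 : 1 + 1 / t = (t / (t + 1))⁻¹ := by
      field_simp
    rw [h4]
    exact (le_inv_comm₀ (by positivity) (Real.exp_pos _)).1 h1
  calc Real.exp (N / (t + 1)) = Real.exp (1 / (t + 1)) ^ N := by
        rw [← Real.exp_nat_mul]
        ring_nf
    _ ≤ _ := by gcongr

/-- The sample size needed for the `ε`-net theorem in dimension four. -/
theorem exists_sample_size {n : ℕ} (hn : 1 ≤ n) :
    ∃ N : ℕ, (N : ℝ) ≤ 48 * Real.exp 1 * n * Real.log (66 * Real.exp 1 * n) ∧
      ((∑ k ∈ Finset.range (4 + 1), (2 * N).choose k : ℕ) : ℝ) < (1 + 1 / (18 * n : ℝ)) ^ N := by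
  have hn' : (1 : ℝ) ≤ n := by exact_mod_cast hn
  have he1 := Real.exp_one_gt_d9
  have he2 := Real.exp_one_lt_d9
  set x := 66 * Real.exp 1 * n with hx
  have hx0 : 0 < x := by positivity
  set L := Real.log x with hLdef
  have hexp : Real.exp L = x := Real.exp_log hx0
  have hL : 5 ≤ L := by
    rw [hLdef, Real.le_log_iff_exp_le hx0]
    have h1 : Real.exp 5 = Real.exp 1 ^ 5 := by
      rw [← Real.exp_nat_mul]
      norm_num
    calc Real.exp 5 = Real.exp 1 ^ 5 := h1
      _ ≤ 2.72 ^ 5 := by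
        gcongr
        linarith
      _ ≤ 66 * 2.7 * 1 := by norm_num
      _ ≤ x := by
        rw [hx]
        gcongr
        linarith
  have hM : 48 * Real.exp 1 * n * L = 8 / 11 * x * L := by
    rw [hx]
    ring
  set M := 48 * Real.exp 1 * n * L with hMdef
  have hM0 : 0 ≤ M := by positivity
  have hM1 : 130 * n * L ≤ M := by
    rw [hMdef]
    gcongr
    linarith
  have hNle := Nat.floor_le hM0
  have hNgt := Nat.lt_floor_add_one M
  set N := ⌊M⌋₊ with hN
  refine ⟨N, hNle, ?_⟩
  have hnL : 5 ≤ n * L := by nlinarith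
  have hNpos : 0 < N := by
    have : (0 : ℝ) < N := by linarith
    exact_mod_cast this
  have h1 : ((∑ k ∈ Finset.range (4 + 1), (2 * N).choose k : ℕ) : ℝ) ≤ 5 * (2 * M) ^ 4 := by
    have := sum_choose_le_mul_pow (m := 2 * N) (by omega) 4
    calc ((∑ k ∈ Finset.range (4 + 1), (2 * N).choose k : ℕ) : ℝ)
        ≤ (((4 + 1) * (2 * N) ^ 4 : ℕ) : ℝ) := by exact_mod_cast this
      _ = 5 * (2 * (N : ℝ)) ^ 4 := by
        push_cast
        norm_num
      _ ≤ _ := by gcongr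
  have h2 : 5 * (2 * M) ^ 4 ≤ 552 * Real.exp (5 * L) := by
    have h3 : L ^ 4 ≤ 24 * x := by
      have := Real.pow_div_factorial_le_exp L (by linarith) 4
      rw [hexp] at this
      norm_num [Nat.factorial] at this
      linarith
    have h4 : Real.exp (5 * L) = x ^ 5 := by
      rw [← hexp, ← Real.exp_nat_mul]
      norm_num
    rw [h4, hM]
    calc 5 * (2 * (8 / 11 * x * L)) ^ 4 = 5 * (16 / 11) ^ 4 * x ^ 4 * L ^ 4 := by ring
      _ ≤ 23 * x ^ 4 * (24 * x) := by
        gcongr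
        norm_num
      _ = 552 * x ^ 5 := by ring
  have h3 : (552 : ℝ) < Real.exp 7 := by
    have h4 : Real.exp 7 = Real.exp 1 ^ 7 := by
      rw [← Real.exp_nat_mul]
      norm_num
    calc (552 : ℝ) < 2.7 ^ 7 := by norm_num
      _ ≤ Real.exp 1 ^ 7 := by
        gcongr
        linarith
      _ = _ := h4.symm
  have h4 : 7 + 5 * L ≤ N / (18 * n + 1) := by
    rw [le_div_iff₀ (by positivity)]
    nlinarith
  calc ((∑ k ∈ Finset.range (4 + 1), (2 * N).choose k : ℕ) : ℝ)
      ≤ 552 * Real.exp (5 * L) := h1.trans h2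
    _ < Real.exp 7 * Real.exp (5 * L) := by gcongr
    _ = Real.exp (7 + 5 * L) := (Real.exp_add _ _).symm
    _ ≤ Real.exp (N / (18 * n + 1)) := Real.exp_le_exp.2 h4
    _ ≤ _ := exp_div_le_one_add_pow (by positivity) N

theorem card_le_matchingNumber {V : Type*} [Fintype V] {E : Set (Set V)} {M : Finset (Set V)}
    (hM : (M : Set (Set V)) ⊆ E) (hd : (M : Set (Set V)).Pairwise Disjoint) :
    M.card ≤ matchingNumber E := by
  classical
  refine le_csSup ⟨Fintype.card (Set V), ?_⟩ ⟨M, hM, hd, rfl⟩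
  rintro _ ⟨M, -, -, rfl⟩
  exact Finset.card_le_univ M

theorem transversalNumber_le {V : Type*} [Fintype V] {E : Set (Set V)} {N : ℕ} (x : Fin N → V)
    (hx : ∀ e ∈ E, ∃ i, x i ∈ e) : transversalNumber E ≤ N := by
  classical
  have h : transversalNumber E ≤ (Finset.univ.image x).card :=
    Nat.sInf_le ⟨Finset.univ.image x, fun e he => by
      obtain ⟨i, hi⟩ := hx e he
      exact ⟨x i, Finset.mem_image_of_mem x (Finset.mem_univ i), hi⟩, rfl⟩
  exact h.trans (Finset.card_image_le.trans (by simp))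

/-- In a nonempty ball hypergraph of a graph without a `K₅` minor, some probability weight on the
vertices gives weight at least `1 / (18 ν)` to each edge. -/
theorem exists_fractional_transversal_of_isBallHypergraph {V : Type*} [Fintype V]
    {G : SimpleGraph V} (hG : ¬ HasK5MinorIn G Set.univ) {E : Set (Set V)}
    (hE : IsBallHypergraph G E) (hν : 1 ≤ matchingNumber E) [Nonempty V] :
    ∃ μ ∈ stdSimplex ℝ V, ∀ e ∈ E, 1 / (18 * matchingNumber E : ℝ) ≤ ∑ v, e.indicator μ v := by
  classical
  let ι := {e : Set V // Minimal (· ∈ E) e}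
  have hball : ∀ i : ι, ∃ c r, i.1 = G.gBall c r := fun i => hE i.1 i.2.prop
  choose c r hcr using hball
  have hanti : ∀ i j : ι, i ≠ j → ¬ G.gBall (c i) (r i) ⊆ G.gBall (c j) (r j) := by
    intro i j hij hsub
    rw [← hcr i, ← hcr j] at hsub
    exact hij (Subtype.ext (j.2.eq_of_subset i.2.prop hsub))
  have hν' : (1 : ℝ) ≤ matchingNumber E := by exact_mod_cast hν
  obtain ⟨μ, hμ, h⟩ := exists_fractional_transversal (fun i : ι => i.1)
    (t := 18 * matchingNumber E) (by positivity) (by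
      intro w hw hload
      obtain ⟨M, hM, hsum⟩ := exists_packing_of_antichain hG hanti w hw (by
        intro v
        simpa only [← hcr] using hload v)
      have hcard := card_le_matchingNumber (E := E)
        (M := M.map (Function.Embedding.subtype fun e => Minimal (· ∈ E) e)) (by
          intro e he
          obtain ⟨i, -, rfl⟩ := Finset.mem_map.1 (Finset.mem_coe.1 he)
          exact i.2.prop) (by
          intro e he e' he' hne
          obtain ⟨i, hi, rfl⟩ := Finset.mem_map.1 (Finset.mem_coe.1 he)
          obtain ⟨j, hj, rfl⟩ := Finset.mem_map.1 (Finset.mem_coe.1 he')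
          have := hM i hi j hj fun h => hne (congrArg _ h)
          rwa [← hcr, ← hcr] at this)
      rw [Finset.card_map] at hcard
      refine hsum.trans ?_
      gcongr)
  refine ⟨μ, hμ, fun e he => ?_⟩
  obtain ⟨m, hme, hm⟩ := (Set.toFinite E).exists_le_minimal he
  refine (h ⟨m, hm⟩).trans (Finset.sum_le_sum fun v _ => ?_)
  exact Set.indicator_le_indicator_of_subset hme hμ.1 v

/-- For every planar graph `G` and every ball hypergraph `𝓗` of `G`,
`τ(𝓗) ≤ 48e·ν(𝓗)·log(66e·ν(𝓗))`. -/
theorem tau_le_nearlinear_planar {V : Type} [Fintype V] (G : SimpleGraph V)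
    (hG : IsPlanar G) (E : Set (Set V)) (hE : IsBallHypergraph G E) :
    (transversalNumber E : ℝ) ≤
      48 * Real.exp 1 * (matchingNumber E : ℝ) *
        Real.log (66 * Real.exp 1 * (matchingNumber E : ℝ)) := by
  classical
  have hK : ¬ HasK5MinorIn G Set.univ := fun h => hG.1 h.graphMinor
  rcases E.eq_empty_or_nonempty with rfl | ⟨e, he⟩
  · have h0 : transversalNumber (∅ : Set (Set V)) = 0 :=
      Nat.sInf_eq_zero.2 (Or.inl ⟨∅, by simp, rfl⟩)
    have h1 : matchingNumber (∅ : Set (Set V)) = 0 := by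
      refine Nat.le_zero.1 (csSup_le' ?_)
      rintro _ ⟨M, hM, -, rfl⟩
      rw [Finset.coe_eq_empty.1 (Set.subset_empty_iff.1 hM), Finset.card_empty]
    simp [h0, h1]
  have hν : 1 ≤ matchingNumber E := by
    simpa using card_le_matchingNumber (E := E) (M := {e}) (by simpa using he) (by simp)
  have : Nonempty V := by
    obtain ⟨v, -, -⟩ := hE e he
    exact ⟨v⟩
  obtain ⟨N, hN, hlt⟩ := exists_sample_size hν
  obtain ⟨μ, hμ, hw⟩ := exists_fractional_transversal_of_isBallHypergraph hK hE hν
  have hmem : ∀ b : Finset V, b ∈ Finset.univ.filter (fun b : Finset V => (b : Set V) ∈ E) →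
      (b : Set V) ∈ E := fun b hb => (Finset.mem_filter.1 hb).2
  obtain ⟨x, hx⟩ := exists_net hμ
    (card_le_four_of_shatters hK fun b hb => hE _ (hmem b hb)) (by positivity)
    (fun b hb => by
      rw [← Finset.sum_indicator_subset μ (Finset.subset_univ b)]
      exact hw _ (hmem b hb)) hlt
  refine le_trans ?_ hN
  exact_mod_cast transversalNumber_le x fun e he => by
    obtain ⟨b, rfl⟩ := (Set.toFinite e).exists_finset_coe
    exact hx b (Finset.mem_filter.2 ⟨Finset.mem_univ b, he⟩)
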